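/- arXiv:2511.02790 — 3 statements merged into one kernel-verified Lean document; each statement's English description precedes it below -/
import Mathlib

section
/- Let g ≥ 3 and set ℓ := ⌈384 g³ log K⌉. There exist constants c = c(g) > 0 and K_0 = K_0(g) such that for all integers K ≥ K_0, every integer k with |k − μ_K| ≤ C_g, and every real θ with K^{3/4} g^{−K} ≤ ‖(g−1)θ‖_{ℝ/ℤ} ≤ g^{−K+2ℓ²}, one has |f_k(θ)| ≤ c · g^K K^{−5/4}. -/
set_option autoImplicit false

noncomputable section

/-- `e(x) = exp(2πix)`. -/
def eC (x : ℝ) : ℂ := Complex.exp (2 * Real.pi * Complex.I * x)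

/-- Base-`g` digit sum. -/
def digitSum (g n : ℕ) : ℕ := (Nat.digits g n).sum

/-- `S_g(k)`: naturals below `g^K` with base-`g` digit sum `k`. -/
def Sset (g K : ℕ) (k : ℤ) : Finset ℕ :=
  (Finset.range (g ^ K)).filter fun n => (digitSum g n : ℤ) = k

/-- The exponential sum `f_k(θ) = Σ_{n ∈ S_g(k)} e(nθ)`. -/
def fsum (g K : ℕ) (k : ℤ) (θ : ℝ) : ℂ := ∑ n ∈ Sset g K k, eC ((n : ℝ) * θ)

/-- The average digit sum `μ_K = (g-1)K/2`. -/
def muK (g K : ℕ) : ℝ := ((g : ℝ) - 1) * K / 2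

/-- `C_g = g(g-1) ∏_{p ≤ 10g², p prime} p`. -/
def Cg (g : ℕ) : ℕ := g * (g - 1) * ∏ p ∈ (Finset.Iic (10 * g ^ 2)).filter Nat.Prime, p

/-- Distance to the nearest integer. -/
def distToInt (x : ℝ) : ℝ := |x - round x|

/-- `ℓ = ⌈384 g³ log K⌉`. -/
def ellK (g K : ℕ) : ℤ := ⌈(384 : ℝ) * (g : ℝ) ^ 3 * Real.log K⌉

lemma eC_eq_exp_I_mul (x : ℝ) : eC x = Complex.exp (Complex.I * ((2 * Real.pi * x : ℝ) : ℂ)) := by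
  unfold eC; congr 1; push_cast; ring

lemma eC_add (x y : ℝ) : eC (x + y) = eC x * eC y := by
  unfold eC; rw [← Complex.exp_add]; congr 1; push_cast; ring

lemma eC_nat_mul (n : ℕ) (x : ℝ) : eC (n * x) = eC x ^ n := by
  unfold eC; rw [← Complex.exp_nat_mul]; congr 1; push_cast; ring

lemma eC_intCast (m : ℤ) : eC m = 1 := by
  unfold eC
  rw [← Complex.exp_int_mul_two_pi_mul_I m]; congr 1; push_cast; ring

lemma norm_eC (x : ℝ) : ‖eC x‖ = 1 := by
  rw [eC_eq_exp_I_mul, Complex.norm_exp_I_mul_ofReal]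

lemma re_eC (x : ℝ) : (eC x).re = Real.cos (2 * Real.pi * x) := by
  rw [eC_eq_exp_I_mul, mul_comm, Complex.exp_ofReal_mul_I_re]

lemma im_eC (x : ℝ) : (eC x).im = Real.sin (2 * Real.pi * x) := by
  rw [eC_eq_exp_I_mul, mul_comm, Complex.exp_ofReal_mul_I_im]

lemma norm_eC_sub_one (x : ℝ) : ‖eC x - 1‖ = 2 * |Real.sin (Real.pi * x)| := by
  rw [eC_eq_exp_I_mul, Complex.norm_exp_I_mul_ofReal_sub_one, Real.norm_eq_abs, abs_mul, abs_two]
  congr 3; ring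

lemma norm_eC_sub_one_le (x : ℝ) : ‖eC x - 1‖ ≤ 2 * Real.pi * |x| := by
  rw [eC_eq_exp_I_mul]
  refine Real.norm_exp_I_mul_ofReal_sub_one_le.trans ?_
  rw [Real.norm_eq_abs, abs_mul, abs_of_pos Real.two_pi_pos]

lemma abs_le_abs_sin_pi_mul {x : ℝ} (hx : |x| ≤ 1 / 2) : 2 * |x| ≤ |Real.sin (Real.pi * x)| := by
  have hpi := Real.pi_pos
  have h : |Real.pi * x| ≤ Real.pi / 2 := by
    rw [abs_mul, abs_of_pos hpi]; nlinarith
  have := Real.mul_abs_le_abs_sin h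
  rw [abs_mul, abs_of_pos hpi] at this
  calc 2 * |x| = 2 / Real.pi * (Real.pi * |x|) := by field_simp
    _ ≤ _ := this

lemma four_mul_abs_le_norm_eC_sub_one {x : ℝ} (hx : |x| ≤ 1 / 2) : 4 * |x| ≤ ‖eC x - 1‖ := by
  rw [norm_eC_sub_one]; linarith [abs_le_abs_sin_pi_mul hx]

lemma norm_sum_eC_mul_le {x : ℝ} (hx : |x| ≤ 1 / 2) (hx0 : x ≠ 0) (n : ℕ) :
    ‖∑ u ∈ Finset.range n, eC (u * x)‖ ≤ 1 / (2 * |x|) := by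
  have h4 := four_mul_abs_le_norm_eC_sub_one hx
  have hpos : 0 < |x| := abs_pos.mpr hx0
  have hgeom := geom_sum_mul (eC x) n
  simp_rw [← eC_nat_mul] at hgeom
  have hle : ‖∑ u ∈ Finset.range n, eC (u * x)‖ * ‖eC x - 1‖ ≤ 2 := by
    rw [← norm_mul, hgeom]
    refine (norm_sub_le _ _).trans ?_
    rw [norm_eC, norm_one]; norm_num
  rw [le_div_iff₀ (by positivity)]
  nlinarith [norm_nonneg (∑ u ∈ Finset.range n, eC (u * x))]

lemma digitSum_eq_mod_add_div {g : ℕ} (hg : 2 ≤ g) (n : ℕ) :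
    digitSum g n = n % g + digitSum g (n / g) := by
  rcases Nat.eq_zero_or_pos n with rfl | hn
  · simp [digitSum]
  · simp only [digitSum]
    rw [Nat.digits_def' (by omega) hn, List.sum_cons]

lemma digitSum_add_mul_pow {g : ℕ} (hg : 2 ≤ g) (M u v : ℕ) (hv : v < g ^ M) :
    digitSum g (v + u * g ^ M) = digitSum g v + digitSum g u := by
  induction M generalizing v with
  | zero =>
    obtain rfl : v = 0 := by simpa using hv
    simp [digitSum]
  | succ M ih =>
    have h1 : (v + u * g ^ (M + 1)) % g = v % g := by
      rw [pow_succ, ← mul_assoc, Nat.add_mul_mod_self_right]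
    have h2 : (v + u * g ^ (M + 1)) / g = v / g + u * g ^ M := by
      rw [pow_succ, ← mul_assoc, Nat.add_mul_div_right _ _ (by omega)]
    rw [digitSum_eq_mod_add_div hg, h1, h2, ih, digitSum_eq_mod_add_div hg v, add_assoc]
    exact Nat.div_lt_of_lt_mul (by rwa [pow_succ, mul_comm] at hv)

lemma digitSum_of_lt {g : ℕ} (hg : 2 ≤ g) {d : ℕ} (hd : d < g) : digitSum g d = d := by
  rw [digitSum_eq_mod_add_div hg, Nat.mod_eq_of_lt hd, Nat.div_eq_of_lt hd]
  simp [digitSum]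

lemma digitSum_le {g : ℕ} (hg : 2 ≤ g) (L u : ℕ) (hu : u < g ^ L) :
    digitSum g u ≤ (g - 1) * L := by
  induction L generalizing u with
  | zero =>
    obtain rfl : u = 0 := by simpa using hu
    simp [digitSum]
  | succ L ih =>
    rw [digitSum_eq_mod_add_div hg]
    have := ih (u / g) (Nat.div_lt_of_lt_mul (by rwa [pow_succ, mul_comm] at hu))
    have := Nat.mod_lt u (show g > 0 by omega)
    rw [mul_add]
    omega

lemma sum_range_mul {α : Type*} [AddCommMonoid α] (F : ℕ → α) (a b : ℕ) :
    ∑ n ∈ Finset.range (a * b), F n =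
      ∑ u ∈ Finset.range a, ∑ v ∈ Finset.range b, F (v + u * b) := by
  induction a with
  | zero => simp
  | succ a ih =>
    rw [Nat.succ_mul, Finset.sum_range_add, ih, Finset.sum_range_succ]
    simp only [add_comm]

lemma sum_pow_digitSum {g : ℕ} (hg : 2 ≤ g) (M : ℕ) (z : ℂ) :
    ∑ v ∈ Finset.range (g ^ M), z ^ digitSum g v = (∑ d ∈ Finset.range g, z ^ d) ^ M := by
  induction M with
  | zero => simp [digitSum]
  | succ M ih =>
    rw [pow_succ, sum_range_mul, pow_succ, ← ih, Finset.sum_mul]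
    refine Finset.sum_congr rfl fun u _ => ?_
    rw [Finset.mul_sum]
    refine Finset.sum_congr rfl fun d hd => ?_
    have hd := Finset.mem_range.mp hd
    have := digitSum_add_mul_pow hg 1 u d (by simpa using hd)
    rw [pow_one] at this
    rw [this, digitSum_of_lt hg hd, pow_add, mul_comm]

lemma fsum_eq_sum_ite (g K : ℕ) (k : ℤ) (θ : ℝ) :
    fsum g K k θ = ∑ n ∈ Finset.range (g ^ K), if (digitSum g n : ℤ) = k then eC (n * θ) else 0 := by
  rw [fsum, Sset, Finset.sum_filter]

lemma fsum_add {g : ℕ} (hg : 2 ≤ g) (M L : ℕ) (k : ℤ) (θ : ℝ) :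
    fsum g (M + L) k θ =
      ∑ u ∈ Finset.range (g ^ L), eC (u * ((g : ℝ) ^ M * θ)) * fsum g M (k - digitSum g u) θ := by
  rw [fsum_eq_sum_ite, add_comm M L, pow_add, sum_range_mul]
  refine Finset.sum_congr rfl fun u _ => ?_
  rw [fsum_eq_sum_ite, Finset.mul_sum]
  refine Finset.sum_congr rfl fun v hv => ?_
  rw [digitSum_add_mul_pow hg M u v (Finset.mem_range.mp hv), mul_ite, mul_zero, ← eC_add]
  refine if_congr ?_ ?_ rfl
  · push_cast; constructor <;> intro h <;> linarith
  · congr 1; push_cast; ring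

lemma card_Sset_le (g M : ℕ) (j : ℤ) : (Sset g M j).card ≤ g ^ M :=
  (Finset.card_filter_le _ _).trans (by simp)

lemma norm_fsum_sub_card_le (g M : ℕ) (j : ℤ) (θ : ℝ) :
    ‖fsum g M j θ - (Sset g M j).card‖ ≤ (g : ℝ) ^ M * (2 * Real.pi * ((g : ℝ) ^ M * |θ|)) := by
  have h : fsum g M j θ - (Sset g M j).card = ∑ n ∈ Sset g M j, (eC (n * θ) - 1) := by
    simp [fsum]
  rw [h]
  refine (norm_sum_le_of_le (f := fun n : ℕ => eC (n * θ) - 1) _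
    (n := fun _ => 2 * Real.pi * ((g : ℝ) ^ M * |θ|)) ?_).trans ?_
  · intro n hn
    have hn : n < g ^ M := Finset.mem_range.mp (Finset.mem_filter.mp hn).1
    have hn' : (n : ℝ) ≤ (g : ℝ) ^ M := by exact_mod_cast hn.le
    refine (norm_eC_sub_one_le _).trans ?_
    rw [abs_mul, Nat.abs_cast]
    have := Real.pi_pos
    gcongr
  · rw [Finset.sum_const, nsmul_eq_mul]
    have := Real.pi_pos
    gcongr
    exact_mod_cast card_Sset_le g M j

/-- The real symmetrised generating function of a single base-`g` digit. -/
def digitCos (g : ℕ) (t : ℝ) : ℝ :=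
  ∑ d ∈ Finset.range g, Real.cos (2 * Real.pi * (t * (d - ((g : ℝ) - 1) / 2)))

lemma sum_eC_eq_mul_digitCos (g : ℕ) (t : ℝ) :
    ∑ d ∈ Finset.range g, eC t ^ d = eC (t * (((g : ℝ) - 1) / 2)) * digitCos g t := by
  have hsin : ∑ d ∈ Finset.range g, Real.sin (2 * Real.pi * (t * (d - ((g : ℝ) - 1) / 2))) = 0 := by
    have h := Finset.sum_range_reflect
      (fun d : ℕ => Real.sin (2 * Real.pi * (t * (d - ((g : ℝ) - 1) / 2)))) g
    have h2 : ∑ d ∈ Finset.range g,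
          Real.sin (2 * Real.pi * (t * (((g - 1 - d : ℕ) : ℝ) - ((g : ℝ) - 1) / 2)))
        = -∑ d ∈ Finset.range g, Real.sin (2 * Real.pi * (t * (d - ((g : ℝ) - 1) / 2))) := by
      rw [← Finset.sum_neg_distrib]
      refine Finset.sum_congr rfl fun d hd => ?_
      have hd := Finset.mem_range.mp hd
      rw [← Real.sin_neg, Nat.sub_sub, Nat.cast_sub (by omega)]
      congr 1; push_cast; ring
    linarith
  have hre : (digitCos g t : ℂ) =
      ∑ d ∈ Finset.range g, eC (t * (d - ((g : ℝ) - 1) / 2)) := by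
    apply Complex.ext
    · rw [Complex.ofReal_re, Complex.re_sum]
      simp only [re_eC, digitCos]
    · simp [im_eC, hsin]
  rw [hre, Finset.mul_sum]
  refine Finset.sum_congr rfl fun d _ => ?_
  rw [← eC_add, ← eC_nat_mul]
  congr 1; ring

lemma abs_digitCos_eq_norm (g : ℕ) (t : ℝ) :
    |digitCos g t| = ‖∑ d ∈ Finset.range g, eC t ^ d‖ := by
  rw [sum_eC_eq_mul_digitCos, norm_mul, norm_eC, one_mul, Complex.norm_real, Real.norm_eq_abs]

lemma cos_pi_mul_le {t : ℝ} (ht : |t| ≤ 1) : Real.cos (Real.pi * t) ≤ 1 - 2 * t ^ 2 := by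
  have h := abs_le_abs_sin_pi_mul (x := t / 2) (by rw [abs_div, abs_two]; linarith)
  have h2 : Real.cos (Real.pi * t) = 1 - 2 * Real.sin (Real.pi * (t / 2)) ^ 2 := by
    rw [show Real.pi * t = 2 * (Real.pi * (t / 2)) by ring, Real.cos_two_mul]
    nlinarith [Real.sin_sq_add_cos_sq (Real.pi * (t / 2))]
  have h3 : |t| ≤ |Real.sin (Real.pi * (t / 2))| := by
    rw [abs_div, abs_two] at h; linarith
  rw [h2]
  linarith [sq_le_sq.mpr h3]

lemma abs_digitCos_le {g : ℕ} (hg : 2 ≤ g) {t : ℝ} (ht : |t| ≤ 1 / 2) :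
    |digitCos g t| ≤ g * Real.exp (-(4 / g) * t ^ 2) := by
  have hg0 : (0 : ℝ) < g := by positivity
  have hone : ‖1 + eC t‖ ≤ 2 - 4 * t ^ 2 := by
    have hneg : eC (1 / 2) = -1 := by
      unfold eC
      rw [← Complex.exp_pi_mul_I]; congr 1; push_cast; ring
    have h : 1 + eC t = -(eC (t + 1 / 2) - 1) := by rw [eC_add, hneg]; ring
    have hc : 0 ≤ Real.cos (Real.pi * t) := by
      have := abs_le.mp ht
      apply Real.cos_nonneg_of_mem_Icc
      constructor <;> nlinarith [Real.pi_pos]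
    rw [h, norm_neg, norm_eC_sub_one, show Real.pi * (t + 1 / 2) = Real.pi * t + Real.pi / 2 by ring,
      Real.sin_add_pi_div_two, abs_of_nonneg hc]
    linarith [cos_pi_mul_le (t := t) (by linarith)]
  have hsum : ‖∑ d ∈ Finset.range g, eC t ^ d‖ ≤ g - 4 * t ^ 2 := by
    obtain ⟨m, rfl⟩ := Nat.exists_eq_add_of_le hg
    rw [Finset.sum_range_add]
    refine (norm_add_le _ _).trans ?_
    have h1 : ‖∑ x ∈ Finset.range m, eC t ^ (2 + x)‖ ≤ m := by
      refine (norm_sum_le _ _).trans ?_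
      simp [norm_eC]
    have h2 : ∑ x ∈ Finset.range 2, eC t ^ x = 1 + eC t := by
      simp [Finset.sum_range_succ]
    rw [h2]
    push_cast
    linarith
  rw [abs_digitCos_eq_norm]
  calc _ ≤ (g : ℝ) - 4 * t ^ 2 := hsum
    _ = g * (-(4 / g) * t ^ 2 + 1) := by field_simp; ring
    _ ≤ _ := by gcongr; exact Real.add_one_le_exp _

lemma continuous_digitCos (g : ℕ) : Continuous (digitCos g) := by
  unfold digitCos; fun_prop

lemma abs_digitCos_pow_le {g : ℕ} (hg : 2 ≤ g) (M : ℕ) {t : ℝ} (ht : |t| ≤ 1 / 2) :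
    |digitCos g t ^ M| ≤ (g : ℝ) ^ M * Real.exp (-(4 * M / g) * t ^ 2) := by
  rw [abs_pow]
  refine (pow_le_pow_left₀ (abs_nonneg _) (abs_digitCos_le hg ht) M).trans_eq ?_
  rw [mul_pow, ← Real.exp_nat_mul]
  congr 2; ring

lemma integral_cos_two_pi_mul_int (m : ℤ) :
    ∫ t in (-(1 / 2) : ℝ)..1 / 2, Real.cos (2 * Real.pi * (t * m)) = if m = 0 then 1 else 0 := by
  split_ifs with hm
  · simp [hm]; norm_num
  · have hm' : (m : ℝ) ≠ 0 := by exact_mod_cast hm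
    have hc : 2 * Real.pi * (m : ℝ) ≠ 0 := by positivity
    have h := intervalIntegral.integral_comp_mul_left (a := (-(1 / 2) : ℝ)) (b := 1 / 2) Real.cos hc
    rw [integral_cos] at h
    rw [show (fun t : ℝ => Real.cos (2 * Real.pi * (t * m))) =
      fun t => Real.cos (2 * Real.pi * m * t) by ext t; congr 1; ring, h]
    rw [show 2 * Real.pi * (m : ℝ) * (1 / 2) = m * Real.pi by ring,
      show 2 * Real.pi * (m : ℝ) * (-(1 / 2)) = -(m * Real.pi) by ring, Real.sin_neg,
      Real.sin_int_mul_pi]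
    simp

lemma sum_cos_digitSum {g : ℕ} (hg : 2 ≤ g) (M : ℕ) (j : ℤ) (t : ℝ) :
    ∑ v ∈ Finset.range (g ^ M), Real.cos (2 * Real.pi * (t * ((digitSum g v - j : ℤ) : ℝ))) =
      digitCos g t ^ M * Real.cos (2 * Real.pi * (t * (muK g M - j))) := by
  have h := sum_pow_digitSum hg M (eC t)
  rw [sum_eC_eq_mul_digitCos, mul_pow, ← eC_nat_mul] at h
  have h2 : ∑ v ∈ Finset.range (g ^ M), eC (t * ((digitSum g v - j : ℤ) : ℝ)) =
      ((digitCos g t ^ M : ℝ) : ℂ) * eC (t * (muK g M - j)) := by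
    calc _ = ∑ v ∈ Finset.range (g ^ M), eC t ^ digitSum g v * eC (-(t * j)) := by
          refine Finset.sum_congr rfl fun v _ => ?_
          rw [← eC_nat_mul, ← eC_add]; congr 1; push_cast; ring
      _ = eC (M * (t * (((g : ℝ) - 1) / 2))) * eC (-(t * j)) * (digitCos g t : ℂ) ^ M := by
          rw [← Finset.sum_mul, h]; ring
      _ = _ := by
          rw [← eC_add, muK, mul_comm]
          congr 1
          · push_cast; rfl
          · congr 1; ring
  have h3 := congrArg Complex.re h2
  rw [Complex.re_ofReal_mul, re_eC, Complex.re_sum] at h3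
  simpa only [re_eC] using h3

lemma card_Sset_eq_integral {g : ℕ} (hg : 2 ≤ g) (M : ℕ) (j : ℤ) :
    ((Sset g M j).card : ℝ) = ∫ t in (-(1 / 2) : ℝ)..1 / 2,
      digitCos g t ^ M * Real.cos (2 * Real.pi * (t * (muK g M - j))) := by
  simp_rw [← sum_cos_digitSum hg]
  rw [intervalIntegral.integral_finsetSum]
  · simp_rw [integral_cos_two_pi_mul_int, sub_eq_zero]
    rw [Sset, Finset.sum_boole]
  · intro v _
    exact Continuous.intervalIntegrable (by fun_prop) _ _

/-- The Fourier integral giving the central value of the digit-sum counts. -/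
def centralCount (g M : ℕ) : ℝ := ∫ t in (-(1 / 2) : ℝ)..1 / 2, digitCos g t ^ M

lemma integral_exp_neg_mul_sq_le {b : ℝ} (hb : 0 < b) :
    ∫ t in (-(1 / 2) : ℝ)..1 / 2, Real.exp (-b * t ^ 2) ≤ √(Real.pi / b) := by
  rw [intervalIntegral.integral_of_le (by norm_num), ← integral_gaussian]
  exact MeasureTheory.setIntegral_le_integral (integrable_exp_neg_mul_sq hb)
    (Filter.Eventually.of_forall fun _ => (Real.exp_pos _).le)

lemma sq_mul_exp_neg_mul_sq_le {b : ℝ} (hb : 0 < b) (t : ℝ) :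
    t ^ 2 * Real.exp (-b * t ^ 2) ≤ 2 / b * Real.exp (-(b / 2) * t ^ 2) := by
  have h : b / 2 * t ^ 2 ≤ Real.exp (b / 2 * t ^ 2) := by
    linarith [Real.add_one_le_exp (b / 2 * t ^ 2)]
  calc _ = 2 / b * ((b / 2 * t ^ 2) * Real.exp (-b * t ^ 2)) := by field_simp
    _ ≤ 2 / b * (Real.exp (b / 2 * t ^ 2) * Real.exp (-b * t ^ 2)) := by gcongr
    _ = _ := by rw [← Real.exp_add]; congr 2; ring

lemma abs_centralCount_le {g M : ℕ} (hg : 2 ≤ g) (hM : 0 < M) :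
    |centralCount g M| ≤ (g : ℝ) ^ M * √(Real.pi / (4 * M / g)) := by
  have hb : (0 : ℝ) < 4 * M / g := by positivity
  refine (intervalIntegral.norm_integral_le_of_norm_le (μ := MeasureTheory.volume)
    (f := fun t => digitCos g t ^ M)
    (by norm_num : (-(1 / 2) : ℝ) ≤ 1 / 2)
    (g := fun t => (g : ℝ) ^ M * Real.exp (-(4 * M / g) * t ^ 2))
    (Filter.Eventually.of_forall fun t ht => ?_)
    (Continuous.intervalIntegrable (by fun_prop) _ _)).trans ?_
  · exact abs_digitCos_pow_le hg M (abs_le.mpr ⟨ht.1.le, ht.2⟩)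
  · rw [intervalIntegral.integral_const_mul]
    gcongr
    exact integral_exp_neg_mul_sq_le hb

lemma abs_card_Sset_sub_centralCount_le {g M : ℕ} (hg : 2 ≤ g) (hM : 0 < M) (j : ℤ) :
    |(Sset g M j).card - centralCount g M| ≤ (g : ℝ) ^ M * (2 * Real.pi ^ 2 * (muK g M - j) ^ 2 *
      (2 / (4 * M / g) * √(Real.pi / (4 * M / g / 2)))) := by
  have hb : (0 : ℝ) < 4 * M / g := by positivity
  set b : ℝ := 4 * M / g with hbdef
  set a : ℝ := muK g M - j with ha
  have hc := continuous_digitCos g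
  rw [card_Sset_eq_integral hg, centralCount, ← intervalIntegral.integral_sub
    (Continuous.intervalIntegrable (by fun_prop) _ _)
    (Continuous.intervalIntegrable (by fun_prop) _ _)]
  refine (intervalIntegral.norm_integral_le_of_norm_le (μ := MeasureTheory.volume)
    (f := fun t => digitCos g t ^ M * Real.cos (2 * Real.pi * (t * a)) - digitCos g t ^ M)
    (by norm_num : (-(1 / 2) : ℝ) ≤ 1 / 2)
    (g := fun t => (g : ℝ) ^ M * (2 * Real.pi ^ 2 * a ^ 2 * (2 / b)) *
      Real.exp (-(b / 2) * t ^ 2))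
    (Filter.Eventually.of_forall fun t ht => ?_)
    (Continuous.intervalIntegrable (by fun_prop) _ _)).trans ?_
  · have h1 := abs_digitCos_pow_le hg M (abs_le.mpr ⟨ht.1.le, ht.2⟩)
    have h2 : |Real.cos (2 * Real.pi * (t * a)) - 1| ≤ 2 * Real.pi ^ 2 * a ^ 2 * t ^ 2 := by
      have := Real.one_sub_sq_div_two_le_cos (x := 2 * Real.pi * (t * a))
      rw [abs_sub_comm, abs_of_nonneg (by linarith [Real.cos_le_one (2 * Real.pi * (t * a))])]
      linarith
    rw [Real.norm_eq_abs, show digitCos g t ^ M * Real.cos (2 * Real.pi * (t * a)) - digitCos g t ^ M =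
      digitCos g t ^ M * (Real.cos (2 * Real.pi * (t * a)) - 1) by ring, abs_mul]
    calc _ ≤ ((g : ℝ) ^ M * Real.exp (-b * t ^ 2)) * (2 * Real.pi ^ 2 * a ^ 2 * t ^ 2) := by
          gcongr
      _ = (g : ℝ) ^ M * (2 * Real.pi ^ 2 * a ^ 2) * (t ^ 2 * Real.exp (-b * t ^ 2)) := by ring
      _ ≤ (g : ℝ) ^ M * (2 * Real.pi ^ 2 * a ^ 2) * (2 / b * Real.exp (-(b / 2) * t ^ 2)) := by
          exact mul_le_mul_of_nonneg_left (sq_mul_exp_neg_mul_sq_le hb t) (by positivity)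
      _ = _ := by ring
  · rw [intervalIntegral.integral_const_mul]
    calc _ ≤ (g : ℝ) ^ M * (2 * Real.pi ^ 2 * a ^ 2 * (2 / b)) * √(Real.pi / (b / 2)) := by
          gcongr; exact integral_exp_neg_mul_sq_le (by positivity)
      _ = _ := by ring

lemma norm_fsum_add_le {g M : ℕ} (hg : 2 ≤ g) (hM : 0 < M) (L : ℕ) (k : ℤ) {C t : ℝ}
    (hk : |k - muK g (M + L)| ≤ C) (ht0 : t ≠ 0) (ht : |(g : ℝ) ^ M * t| ≤ 1 / 2) :
    ‖fsum g (M + L) k t‖ ≤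
      (g : ℝ) ^ (M + L) * (2 * Real.pi * ((g : ℝ) ^ M * |t|)) +
      (g : ℝ) ^ (M + L) * (2 * Real.pi ^ 2 * (C + g * L) ^ 2 *
        (2 / (4 * M / g) * √(Real.pi / (4 * M / g / 2)))) +
      √(Real.pi / (4 * M / g)) / (2 * |t|) := by
  have hg0 : (0 : ℝ) < g := by positivity
  set E1 : ℝ := 2 * Real.pi * ((g : ℝ) ^ M * |t|) with hE1
  set B : ℝ := 2 / (4 * M / g) * √(Real.pi / (4 * M / g / 2)) with hB
  have hB0 : 0 ≤ B := by positivity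
  set A := centralCount g M with hA
  have hsplit : fsum g (M + L) k t =
      ∑ u ∈ Finset.range (g ^ L), eC (u * ((g : ℝ) ^ M * t)) *
        (fsum g M (k - digitSum g u) t - A) +
      (∑ u ∈ Finset.range (g ^ L), eC (u * ((g : ℝ) ^ M * t))) * A := by
    rw [fsum_add hg, Finset.sum_mul, ← Finset.sum_add_distrib]
    exact Finset.sum_congr rfl fun u _ => by ring
  have hterm : ∀ u ∈ Finset.range (g ^ L), ‖eC (u * ((g : ℝ) ^ M * t)) *
      (fsum g M (k - digitSum g u) t - A)‖ ≤
      (g : ℝ) ^ M * E1 + (g : ℝ) ^ M * (2 * Real.pi ^ 2 * (C + g * L) ^ 2 * B) := by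
    intro u hu
    rw [norm_mul, norm_eC, one_mul]
    set j : ℤ := k - digitSum g u with hj
    have h1 := norm_fsum_sub_card_le g M j t
    have h2 := abs_card_Sset_sub_centralCount_le hg hM j
    have h3 : ‖((Sset g M j).card : ℂ) - A‖ = |(Sset g M j).card - centralCount g M| := by
      rw [← Real.norm_eq_abs, ← Complex.norm_real]; push_cast; rfl
    have hs : (digitSum g u : ℝ) ≤ (g - 1) * L := by
      have := digitSum_le hg L u (Finset.mem_range.mp hu)
      have h' : (digitSum g u : ℝ) ≤ ((g - 1 : ℕ) : ℝ) * L := by exact_mod_cast this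
      rwa [Nat.cast_sub (by omega), Nat.cast_one] at h'
    have hs0 : (0 : ℝ) ≤ digitSum g u := Nat.cast_nonneg _
    have hL0 : (0 : ℝ) ≤ L := Nat.cast_nonneg _
    have hgL : (0 : ℝ) ≤ (g - 1) * L := hs0.trans hs
    have ha : |muK g M - j| ≤ C + g * L := by
      have hk' := abs_le.mp hk
      have hmu : muK g (M + L) = muK g M + (g - 1) * L / 2 := by
        simp only [muK]; push_cast; ring
      rw [hmu] at hk'
      rw [hj, abs_le]; push_cast
      constructor <;> nlinarith
    have ha2 : (muK g M - j) ^ 2 ≤ (C + g * L) ^ 2 :=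
      sq_le_sq' (by linarith [(abs_le.mp ha).1]) (abs_le.mp ha).2
    calc _ ≤ ‖fsum g M j t - (Sset g M j).card‖ + ‖((Sset g M j).card : ℂ) - A‖ :=
          norm_sub_le_norm_sub_add_norm_sub _ _ _
      _ ≤ _ := by
          rw [h3]
          refine add_le_add h1 (h2.trans ?_)
          gcongr
  rw [hsplit]
  refine (norm_add_le _ _).trans (add_le_add ?_ ?_)
  · refine (norm_sum_le_of_le _ hterm).trans_eq ?_
    rw [Finset.sum_const, Finset.card_range, nsmul_eq_mul]
    push_cast
    ring
  · rw [norm_mul, Complex.norm_real, Real.norm_eq_abs]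
    have hx0 : (g : ℝ) ^ M * t ≠ 0 := mul_ne_zero (by positivity) ht0
    calc _ ≤ 1 / (2 * |(g : ℝ) ^ M * t|) * ((g : ℝ) ^ M * √(Real.pi / (4 * M / g))) :=
          mul_le_mul (norm_sum_eC_mul_le ht hx0 _) (abs_centralCount_le hg hM) (abs_nonneg _)
            (by positivity)
      _ = _ := by
          have : |t| ≠ 0 := abs_ne_zero.mpr ht0
          rw [abs_mul, abs_of_pos (by positivity : (0 : ℝ) < (g : ℝ) ^ M)]
          field_simp

lemma norm_fsum_eq_of_shift {g : ℕ} (hg : 3 ≤ g) (K : ℕ) (k : ℤ) (a : ℤ) (t : ℝ) :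
    ‖fsum g K k (a / ((g : ℝ) - 1) + t)‖ = ‖fsum g K k t‖ := by
  have hg1 : ((g : ℝ) - 1) ≠ 0 := by
    have : (3 : ℝ) ≤ g := by exact_mod_cast hg
    linarith
  have h : fsum g K k (a / ((g : ℝ) - 1) + t) =
      eC (k * (a / ((g : ℝ) - 1))) * fsum g K k t := by
    rw [fsum, fsum, Finset.mul_sum]
    refine Finset.sum_congr rfl fun n hn => ?_
    have hn : (digitSum g n : ℤ) = k := (Finset.mem_filter.mp hn).2
    have hmod : g % (g - 1) = 1 := by
      rw [Nat.mod_eq_sub_mod (by omega), Nat.mod_eq_of_lt (by omega)]; omega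
    have h1 := (Nat.modEq_digits_sum (g - 1) g hmod n).symm.dvd
    obtain ⟨m, hm⟩ := h1
    change (n : ℤ) - (digitSum g n : ℤ) = _ at hm
    rw [hn] at hm
    have hm' : (n : ℝ) = k + (g - 1) * m := by
      have h2 : ((n : ℤ) : ℝ) - (k : ℝ) = (((g - 1 : ℕ) : ℤ) : ℝ) * m := by exact_mod_cast hm
      rw [Nat.cast_sub (by omega)] at h2
      push_cast at h2
      linarith
    have h3 : (n : ℝ) * (a / ((g : ℝ) - 1) + t) =
        k * (a / ((g : ℝ) - 1)) + n * t + ((m * a : ℤ) : ℝ) := by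
      rw [mul_add, hm']; push_cast; field_simp; ring
    rw [h3, eC_add, eC_intCast, mul_one, eC_add]
  rw [h, norm_mul, norm_eC, one_mul]

lemma eventually_log_pow_le (n : ℕ) {c : ℝ} (hc : 0 < c) :
    ∀ᶠ K : ℕ in Filter.atTop, Real.log K ^ n ≤ c * K := by
  have h := (Real.isLittleO_pow_log_id_atTop (n := n)).bound hc
  filter_upwards [tendsto_natCast_atTop_atTop.eventually h] with K hK
  simp only [id, Real.norm_eq_abs, Nat.abs_cast] at hK
  exact (le_abs_self _).trans hK

lemma exists_nat_ellK_eq {g K : ℕ} (hg : 3 ≤ g) (hK : 1 ≤ Real.log K) :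
    ∃ l : ℕ, ellK g K = l ∧ 2 * Real.log K ≤ l ∧
      (l : ℝ) ≤ (384 * (g : ℝ) ^ 3 + 1) * Real.log K := by
  have hg' : (3 : ℝ) ≤ g := by exact_mod_cast hg
  have hg3 : (1 : ℝ) ≤ (g : ℝ) ^ 3 := one_le_pow₀ (by linarith)
  have h0 : 0 ≤ ellK g K := Int.ceil_nonneg (by positivity)
  obtain ⟨l, hl⟩ := Int.eq_ofNat_of_zero_le h0
  have hlr : (l : ℝ) = (ellK g K : ℝ) := by rw [hl]; simp
  have h1 := Int.le_ceil ((384 : ℝ) * (g : ℝ) ^ 3 * Real.log K)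
  have h2 := Int.ceil_lt_add_one ((384 : ℝ) * (g : ℝ) ^ 3 * Real.log K)
  refine ⟨l, hl, ?_, ?_⟩ <;> rw [hlr, ellK] <;> nlinarith

lemma sqrt_div_eq_sqrt_mul_rpow {a K : ℝ} (ha : 0 ≤ a) (hK : 0 < K) :
    √(a / K) = √a * K ^ (-(1 : ℝ) / 2) := by
  rw [Real.sqrt_div ha, Real.sqrt_eq_rpow K, neg_div, Real.rpow_neg hK.le, div_eq_mul_inv]

lemma sqrt_pi_div_le {g K M : ℝ} (hg : 0 < g) (hK : 0 < K) (hM : K / 2 ≤ M) :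
    √(Real.pi / (4 * M / g)) ≤ √(Real.pi * g) * K ^ (-(1 : ℝ) / 2) := by
  have hpi := Real.pi_pos
  rw [← sqrt_div_eq_sqrt_mul_rpow (by positivity) hK, div_div_eq_mul_div]
  gcongr
  linarith

lemma two_div_mul_sqrt_le {g K M : ℝ} (hg : 0 < g) (hK : 0 < K) (hM : K / 2 ≤ M) :
    2 / (4 * M / g) * √(Real.pi / (4 * M / g / 2)) ≤
      g * √(Real.pi * g) * K ^ (-(3 : ℝ) / 2) := by
  have hpi := Real.pi_pos
  have hM0 : 0 < M := by linarith
  have h1 : 2 / (4 * M / g) ≤ g * K ^ (-1 : ℝ) := by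
    rw [Real.rpow_neg_one, ← div_eq_mul_inv, div_div_eq_mul_div,
      div_le_div_iff₀ (by positivity) hK]
    nlinarith
  have h2 : √(Real.pi / (4 * M / g / 2)) ≤ √(Real.pi * g) * K ^ (-(1 : ℝ) / 2) := by
    rw [show 4 * M / g / 2 = 4 * (M / 2) / g by ring, ← sqrt_div_eq_sqrt_mul_rpow (by positivity) hK,
      div_div_eq_mul_div]
    gcongr
    linarith
  calc _ ≤ (g * K ^ (-1 : ℝ)) * (√(Real.pi * g) * K ^ (-(1 : ℝ) / 2)) := by gcongr
    _ = g * √(Real.pi * g) * (K ^ (-1 : ℝ) * K ^ (-(1 : ℝ) / 2)) := by ring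
    _ = _ := by rw [← Real.rpow_add hK]; norm_num

lemma norm_fsum_le_of_bounds {g K M L : ℕ} {k : ℤ} {C D t : ℝ} (hg : 2 ≤ g) (hM : K = M + L)
    (hK2 : (2 : ℝ) ≤ K) (hMK : (K : ℝ) / 2 ≤ M) (hk : |k - muK g K| ≤ C)
    (hD2 : (C + g * (L : ℝ)) ^ 2 ≤ D ^ 2 * (K : ℝ) ^ ((1 : ℝ) / 4))
    (htlow : (K : ℝ) ^ ((3 : ℝ) / 4) / (g : ℝ) ^ K ≤ g * |t|)
    (htup : (g : ℝ) ^ M * |t| ≤ (K : ℝ) ^ (-2 : ℝ)) :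
    ‖fsum g K k t‖ ≤ (2 * Real.pi + 2 * Real.pi ^ 2 * D ^ 2 * g * √(Real.pi * g) +
      √(Real.pi * g) * g) * (g : ℝ) ^ K * (K : ℝ) ^ (-(5 : ℝ) / 4) := by
  have hpi := Real.pi_pos
  have hg0 : (0 : ℝ) < g := by positivity
  have hKpos : (0 : ℝ) < K := by linarith
  have hKone : (1 : ℝ) ≤ K := by linarith
  have hM0 : 0 < M := by
    have : (0 : ℝ) < M := by linarith
    exact_mod_cast this
  have htpos : 0 < |t| := by
    have : 0 < (g : ℝ) * |t| := lt_of_lt_of_le (by positivity) htlow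
    exact pos_of_mul_pos_right this hg0.le
  have hhalf : |(g : ℝ) ^ M * t| ≤ 1 / 2 := by
    rw [abs_mul, abs_of_pos (by positivity : (0 : ℝ) < (g : ℝ) ^ M)]
    refine htup.trans ?_
    calc (K : ℝ) ^ (-2 : ℝ) ≤ (K : ℝ) ^ (-1 : ℝ) :=
          Real.rpow_le_rpow_of_exponent_le hKone (by norm_num)
      _ = (K : ℝ)⁻¹ := Real.rpow_neg_one _
      _ ≤ 2⁻¹ := by gcongr
      _ = 1 / 2 := by norm_num
  rw [hM] at hk
  have hmain := norm_fsum_add_le hg hM0 L k hk (abs_pos.mp htpos) hhalf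
  rw [← hM] at hmain
  refine hmain.trans ?_
  have hfirst : 2 * Real.pi * ((g : ℝ) ^ M * |t|) ≤ 2 * Real.pi * (K : ℝ) ^ (-(5 : ℝ) / 4) := by
    gcongr
    exact htup.trans (Real.rpow_le_rpow_of_exponent_le hKone (by norm_num))
  have hsecond : 2 * Real.pi ^ 2 * (C + g * (L : ℝ)) ^ 2 *
      (2 / (4 * M / g) * √(Real.pi / (4 * M / g / 2))) ≤
      2 * Real.pi ^ 2 * D ^ 2 * g * √(Real.pi * g) * (K : ℝ) ^ (-(5 : ℝ) / 4) := by
    calc _ ≤ 2 * Real.pi ^ 2 * (D ^ 2 * (K : ℝ) ^ ((1 : ℝ) / 4)) *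
          (g * √(Real.pi * g) * (K : ℝ) ^ (-(3 : ℝ) / 2)) := by
          gcongr ?_ * ?_
          · gcongr
          · exact two_div_mul_sqrt_le hg0 hKpos hMK
      _ = 2 * Real.pi ^ 2 * D ^ 2 * g * √(Real.pi * g) *
          ((K : ℝ) ^ ((1 : ℝ) / 4) * (K : ℝ) ^ (-(3 : ℝ) / 2)) := by ring
      _ = _ := by rw [← Real.rpow_add hKpos]; norm_num
  have hthird : √(Real.pi / (4 * M / g)) / (2 * |t|) ≤
      (g : ℝ) ^ K * (√(Real.pi * g) * g * (K : ℝ) ^ (-(5 : ℝ) / 4)) := by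
    rw [div_le_iff₀ (by positivity)]
    rw [div_le_iff₀ (by positivity)] at htlow
    calc _ ≤ √(Real.pi * g) * (K : ℝ) ^ (-(1 : ℝ) / 2) := sqrt_pi_div_le hg0 hKpos hMK
      _ = √(Real.pi * g) * (K : ℝ) ^ (-(5 : ℝ) / 4) * (K : ℝ) ^ ((3 : ℝ) / 4) := by
          rw [mul_assoc, ← Real.rpow_add hKpos]; norm_num
      _ ≤ √(Real.pi * g) * (K : ℝ) ^ (-(5 : ℝ) / 4) * (g * |t| * (g : ℝ) ^ K) := by gcongr
      _ ≤ 2 * (√(Real.pi * g) * (K : ℝ) ^ (-(5 : ℝ) / 4) * (g * |t| * (g : ℝ) ^ K)) :=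
          le_mul_of_one_le_left (by positivity) (by norm_num)
      _ = _ := by ring
  calc _ ≤ (g : ℝ) ^ K * (2 * Real.pi * (K : ℝ) ^ (-(5 : ℝ) / 4)) +
        (g : ℝ) ^ K * (2 * Real.pi ^ 2 * D ^ 2 * g * √(Real.pi * g) * (K : ℝ) ^ (-(5 : ℝ) / 4)) +
        (g : ℝ) ^ K * (√(Real.pi * g) * g * (K : ℝ) ^ (-(5 : ℝ) / 4)) := by gcongr
    _ = _ := by ring

lemma sq_add_mul_le {C g B y K L : ℝ} (hC : 0 ≤ C) (hg : 0 ≤ g) (hL0 : 0 ≤ L) (hy : 1 ≤ y)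
    (h16 : y ^ 16 ≤ K) (hL : L ≤ 3 * B ^ 2 * y ^ 2) :
    (C + g * L) ^ 2 ≤ (C + 3 * g * B ^ 2) ^ 2 * K ^ ((1 : ℝ) / 4) := by
  have h1 : C + g * L ≤ (C + 3 * g * B ^ 2) * y ^ 2 := by
    have hy2 : (1 : ℝ) ≤ y ^ 2 := one_le_pow₀ hy
    calc C + g * L ≤ C * y ^ 2 + g * (3 * B ^ 2 * y ^ 2) := by
          gcongr; exact le_mul_of_one_le_right hC hy2
      _ = (C + 3 * g * B ^ 2) * y ^ 2 := by ring
  have h3 : y ^ 4 ≤ K ^ ((1 : ℝ) / 4) := by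
    have h4 : (y ^ 4) ^ (4 : ℝ) ≤ K := by
      rwa [show (4 : ℝ) = ((4 : ℕ) : ℝ) by norm_num, Real.rpow_natCast, ← pow_mul]
    calc y ^ 4 = ((y ^ 4) ^ (4 : ℝ)) ^ ((1 : ℝ) / 4) := by
          rw [← Real.rpow_mul (by positivity)]; norm_num
      _ ≤ _ := by gcongr
  calc _ ≤ ((C + 3 * g * B ^ 2) * y ^ 2) ^ 2 := by gcongr
    _ = (C + 3 * g * B ^ 2) ^ 2 * y ^ 4 := by ring
    _ ≤ _ := by gcongr

theorem statement9 (g : ℕ) (hg : 3 ≤ g) :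
    ∃ c : ℝ, 0 < c ∧ ∃ K0 : ℕ, ∀ K : ℕ, K0 ≤ K →
      ∀ k : ℤ, |(k : ℝ) - muK g K| ≤ Cg g →
      ∀ θ : ℝ,
        (K : ℝ) ^ ((3 : ℝ) / 4) * ((g : ℝ) ^ K)⁻¹ ≤ distToInt (((g : ℝ) - 1) * θ) →
        distToInt (((g : ℝ) - 1) * θ) ≤ (g : ℝ) ^ (-(K : ℤ) + 2 * ellK g K ^ 2) →
        ‖fsum g K k θ‖ ≤ c * (g : ℝ) ^ K * (K : ℝ) ^ (-(5 : ℝ) / 4) := by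
  have hg' : (3 : ℝ) ≤ g := by exact_mod_cast hg
  have hg0 : (0 : ℝ) < g := by linarith
  set B : ℝ := 384 * (g : ℝ) ^ 3 + 1
  have hB1 : 1 ≤ B := by
    have : (0 : ℝ) ≤ (g : ℝ) ^ 3 := by positivity
    linarith
  set D : ℝ := Cg g + 3 * g * B ^ 2
  have hpi := Real.pi_pos
  refine ⟨2 * Real.pi + 2 * Real.pi ^ 2 * D ^ 2 * g * √(Real.pi * g) + √(Real.pi * g) * g,
    by positivity, ?_⟩
  rw [← Filter.eventually_atTop]
  filter_upwards [(Real.tendsto_log_atTop.comp tendsto_natCast_atTop_atTop).eventually_ge_atTop 1,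
    eventually_log_pow_le 2 (show 0 < 1 / (6 * B ^ 2) by positivity),
    eventually_log_pow_le 16 one_pos, Filter.eventually_ge_atTop 1]
    with K hy h2 h16 hK1 k hk θ hlow hup
  change 1 ≤ Real.log K at hy
  set y := Real.log K with hydef
  have hKpos : (0 : ℝ) < K := by exact_mod_cast hK1
  have hKone : (1 : ℝ) ≤ K := by exact_mod_cast hK1
  obtain ⟨l, hl, hl2, hlB⟩ := exists_nat_ellK_eq hg hy
  have hLbound : ((2 * l ^ 2 + l : ℕ) : ℝ) ≤ 3 * B ^ 2 * y ^ 2 := by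
    have h1 : (l : ℝ) ^ 2 ≤ (B * y) ^ 2 := by gcongr
    have h3 : 1 ≤ B * y := one_le_mul_of_one_le_of_one_le hB1 hy
    push_cast
    nlinarith
  have hLK : ((2 * l ^ 2 + l : ℕ) : ℝ) ≤ K / 2 := by
    refine hLbound.trans ?_
    calc 3 * B ^ 2 * y ^ 2 ≤ 3 * B ^ 2 * (1 / (6 * B ^ 2) * (K : ℝ)) := by gcongr
      _ = (K : ℝ) / 2 := by field_simp; norm_num
  obtain ⟨M, hM⟩ : ∃ M, K = M + (2 * l ^ 2 + l) :=
    Nat.exists_eq_add_of_le' (by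
      have : ((2 * l ^ 2 + l : ℕ) : ℝ) ≤ K := hLK.trans (by linarith)
      exact_mod_cast this)
  set L : ℕ := 2 * l ^ 2 + l with hL
  have hMK : (K : ℝ) / 2 ≤ M := by
    have : (K : ℝ) = M + L := by exact_mod_cast hM
    linarith
  set a : ℤ := round (((g : ℝ) - 1) * θ) with ha
  set t : ℝ := (((g : ℝ) - 1) * θ - a) / (g - 1) with ht
  have hg1 : (0 : ℝ) < g - 1 := by linarith
  have hθ : θ = a / ((g : ℝ) - 1) + t := by rw [ht]; field_simp; ring
  have hdist : distToInt (((g : ℝ) - 1) * θ) = (g - 1) * |t| := by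
    rw [ht, abs_div, abs_of_pos hg1, distToInt, ← ha]; field_simp
  rw [hdist] at hlow hup
  have htlow : (K : ℝ) ^ ((3 : ℝ) / 4) / (g : ℝ) ^ K ≤ g * |t| := by
    rw [div_eq_mul_inv]
    nlinarith [abs_nonneg t]
  have htup : (g : ℝ) ^ M * |t| ≤ (K : ℝ) ^ (-2 : ℝ) := by
    have hexp : (K : ℝ) ^ (2 : ℝ) ≤ (g : ℝ) ^ l := by
      rw [Real.rpow_def_of_pos hKpos]
      calc Real.exp (Real.log K * 2) ≤ Real.exp (l * 1) := Real.exp_le_exp.mpr (by linarith)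
        _ = Real.exp 1 ^ l := Real.exp_nat_mul _ _
        _ ≤ (g : ℝ) ^ l := by gcongr; linarith [Real.exp_one_lt_d9]
    have hz : (g : ℝ) ^ (-(K : ℤ) + 2 * ellK g K ^ 2) = ((g : ℝ) ^ M * (g : ℝ) ^ l)⁻¹ := by
      rw [hl, ← pow_add, ← zpow_natCast, ← zpow_neg]
      congr 1
      rw [hM, hL]; push_cast; ring
    rw [hz] at hup
    have : |t| ≤ ((g : ℝ) ^ M * (g : ℝ) ^ l)⁻¹ := by
      nlinarith [abs_nonneg t]
    calc (g : ℝ) ^ M * |t| ≤ (g : ℝ) ^ M * ((g : ℝ) ^ M * (g : ℝ) ^ l)⁻¹ := by gcongr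
      _ = ((g : ℝ) ^ l)⁻¹ := by field_simp
      _ ≤ ((K : ℝ) ^ (2 : ℝ))⁻¹ := by gcongr
      _ = _ := (Real.rpow_neg hKpos.le _).symm
  rw [hθ, norm_fsum_eq_of_shift hg]
  have hD2 := sq_add_mul_le (Nat.cast_nonneg (Cg g)) hg0.le (Nat.cast_nonneg L) hy
    (by simpa using h16) hLbound
  have hK2 : (2 : ℝ) ≤ K := by linarith [Real.log_le_sub_one_of_pos hKpos]
  exact norm_fsum_le_of_bounds (by omega) hM hK2 hMK hk hD2 htlow htup
end
end

section
/- Let g ≥ 2. There is a constant c = c(g) > 0 such that for every integer T ≥ 1 and every real ν with ν + T(g−1)/2 ∈ ℤ, one has | P(T,ν) − e^{−x²/2}/√(2πσ²T) | ≤ c · T^{−3/2}, where x := ν/√(σ²T). -/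
set_option autoImplicit false

noncomputable section

open scoped Classical

/-- `P(T,ν)`: the probability that `T` independent uniform random variables on
`{0,…,g-1} - (g-1)/2` sum to `ν`. -/
def Pg (g T : ℕ) (ν : ℝ) : ℝ :=
  ((Finset.univ.filter
      (fun y : Fin T → Fin g => ∑ i, ((y i : ℕ) : ℝ) = ν + T * ((g : ℝ) - 1) / 2)).card : ℝ)
    / g ^ T


lemma abs_cos_sub_taylor_le (x : ℝ) : |Real.cos x - (1 - x ^ 2 / 2)| ≤ 3 * x ^ 4 := by
  have h4 : |x| ^ 4 = x ^ 4 := by rw [← abs_pow, abs_of_nonneg (by positivity)]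
  have hx4 : 0 ≤ x ^ 4 := by positivity
  rcases le_total |x| 1 with h | h
  · have := Real.cos_bound h
    rw [h4] at this
    linarith
  · have h2 : 1 ≤ x ^ 2 := by
      rw [← sq_abs]
      nlinarith
    have h24 : x ^ 2 ≤ x ^ 4 := by nlinarith
    have hc := Real.cos_le_one x
    have hc' := Real.neg_one_le_cos x
    rw [abs_le]
    constructor <;> linarith

lemma abs_exp_neg_sub_taylor_le {u : ℝ} (hu : 0 ≤ u) : |Real.exp (-u) - (1 - u)| ≤ u ^ 2 := by
  rcases le_total u 1 with h | h
  · have := Real.abs_exp_sub_one_sub_id_le (x := -u) (by rw [abs_neg, abs_of_nonneg hu]; exact h)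
    rw [neg_sq] at this
    convert this using 2
    ring
  · have h1 : Real.exp (-u) ≤ 1 := Real.exp_le_one_iff.2 (by linarith)
    have h2 := Real.one_sub_le_exp_neg u
    rw [abs_of_nonneg (by linarith)]
    nlinarith

/-- The characteristic function of the uniform distribution on `{0, …, g-1} - (g-1)/2`. -/
def uniformCharFun (g : ℕ) (t : ℝ) : ℝ :=
  (∑ k ∈ Finset.range g, Real.cos (((k : ℝ) - ((g : ℝ) - 1) / 2) * t)) / g

lemma continuous_uniformCharFun (g : ℕ) : Continuous (uniformCharFun g) := by
  unfold uniformCharFun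
  fun_prop

lemma uniformCharFun_eq_sum_exp (g : ℕ) (t : ℝ) :
    (uniformCharFun g t : ℂ) =
      (∑ k : Fin g, Complex.exp (((((k : ℕ) : ℝ) - ((g : ℝ) - 1) / 2) * t : ℝ) * Complex.I)) / g := by
  have hsin : ∑ k ∈ Finset.range g, Real.sin (((k : ℝ) - ((g : ℝ) - 1) / 2) * t) = 0 := by
    have h := Finset.sum_range_reflect
      (fun k : ℕ => Real.sin (((k : ℝ) - ((g : ℝ) - 1) / 2) * t)) g
    have h' : ∑ k ∈ Finset.range g, Real.sin ((((g - 1 - k : ℕ) : ℝ) - ((g : ℝ) - 1) / 2) * t) =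
        -∑ k ∈ Finset.range g, Real.sin (((k : ℝ) - ((g : ℝ) - 1) / 2) * t) := by
      rw [← Finset.sum_neg_distrib]
      refine Finset.sum_congr rfl fun k hk => ?_
      have hk := Finset.mem_range.1 hk
      rw [← Real.sin_neg, Nat.cast_sub (by omega), Nat.cast_sub (by omega)]
      push_cast
      congr 1
      ring
    linarith
  rw [Fin.sum_univ_eq_sum_range
    (fun k : ℕ => Complex.exp ((((k : ℝ) - ((g : ℝ) - 1) / 2) * t : ℝ) * Complex.I))]
  simp only [Complex.exp_mul_I, Finset.sum_add_distrib, ← Finset.sum_mul, ← Complex.ofReal_sin,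
    ← Complex.ofReal_cos, ← Complex.ofReal_sum]
  rw [hsin, uniformCharFun]
  push_cast
  ring

lemma sum_range_centered_sq (g : ℕ) :
    ∑ k ∈ Finset.range g, ((k : ℝ) - ((g : ℝ) - 1) / 2) ^ 2 = g * (((g : ℝ) ^ 2 - 1) / 12) := by
  have key : ∀ (n : ℕ) (c : ℝ), ∑ k ∈ Finset.range n, ((k : ℝ) - c) ^ 2 =
      n * (n - 1) * (2 * n - 1) / 6 - c * (n * (n - 1)) + n * c ^ 2 := by
    intro n c
    induction n with
    | zero => simp
    | succ n ih =>
      rw [Finset.sum_range_succ, ih]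
      push_cast
      ring
  rw [key]
  ring

lemma abs_uniformCharFun_sub_exp_le {g : ℕ} (hg : 2 ≤ g) (t : ℝ) :
    |uniformCharFun g t - Real.exp (-(((g : ℝ) ^ 2 - 1) / 12 * t ^ 2 / 2))| ≤
      (4 * (g : ℝ) ^ 4) * t ^ 4 := by
  have hg' : (2 : ℝ) ≤ g := by exact_mod_cast hg
  have hg0 : (0 : ℝ) < g := by linarith
  set s : ℝ := ((g : ℝ) ^ 2 - 1) / 12 with hs
  have hs0 : 0 ≤ s := by rw [hs]; nlinarith
  have hsg : s ≤ (g : ℝ) ^ 2 := by rw [hs]; nlinarith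
  have ht4 : 0 ≤ t ^ 4 := by positivity
  have h1 : |uniformCharFun g t - (1 - s * t ^ 2 / 2)| ≤ 3 * (g : ℝ) ^ 4 * t ^ 4 := by
    have e : uniformCharFun g t - (1 - s * t ^ 2 / 2) =
        (∑ k ∈ Finset.range g, (Real.cos (((k : ℝ) - ((g : ℝ) - 1) / 2) * t) -
          (1 - (((k : ℝ) - ((g : ℝ) - 1) / 2) * t) ^ 2 / 2))) / g := by
      simp only [Finset.sum_sub_distrib, mul_pow, ← Finset.sum_div, ← Finset.sum_mul,
        sum_range_centered_sq, uniformCharFun, Finset.sum_const, Finset.card_range, nsmul_eq_mul,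
        ← hs]
      generalize ∑ k ∈ Finset.range g, Real.cos (((k : ℝ) - ((g : ℝ) - 1) / 2) * t) = S
      field_simp
    rw [e, abs_div, abs_of_pos hg0, div_le_iff₀ hg0]
    refine (Finset.abs_sum_le_sum_abs _ _).trans ?_
    refine (Finset.sum_le_card_nsmul _ _ (3 * (g : ℝ) ^ 4 * t ^ 4) fun k hk => ?_).trans ?_
    · refine (abs_cos_sub_taylor_le _).trans ?_
      have hk : (k : ℝ) < g := by exact_mod_cast Finset.mem_range.1 hk
      have hk0 : (0 : ℝ) ≤ k := by positivity
      have : ((k : ℝ) - ((g : ℝ) - 1) / 2) ^ 4 ≤ (g : ℝ) ^ 4 := by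
        have := pow_le_pow_left₀ (abs_nonneg ((k : ℝ) - ((g : ℝ) - 1) / 2))
          (abs_le.2 ⟨by linarith, by linarith⟩ : |(k : ℝ) - ((g : ℝ) - 1) / 2| ≤ g) 4
        rwa [← abs_pow, abs_of_nonneg (by positivity)] at this
      rw [mul_pow]
      nlinarith
    · simp
      linarith
  have h2 := abs_exp_neg_sub_taylor_le (u := s * t ^ 2 / 2) (by positivity)
  have h3 : (s * t ^ 2 / 2) ^ 2 ≤ (g : ℝ) ^ 4 * t ^ 4 := by
    have : s ^ 2 ≤ ((g : ℝ) ^ 2) ^ 2 := pow_le_pow_left₀ hs0 hsg 2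
    have h5 : s ^ 2 * t ^ 4 ≤ (g : ℝ) ^ 4 * t ^ 4 := by nlinarith
    have h6 : 0 ≤ s ^ 2 * t ^ 4 := by positivity
    nlinarith
  rw [abs_le] at *
  constructor <;> linarith [h1.1, h1.2, h2.1, h2.2]

lemma abs_uniformCharFun_le_exp {g : ℕ} (hg : 2 ≤ g) {t : ℝ} (ht : |t| ≤ Real.pi) :
    |uniformCharFun g t| ≤ Real.exp (-(1 / (g * Real.pi ^ 2) * t ^ 2)) := by
  have hpi := Real.pi_pos
  obtain ⟨n, rfl⟩ := Nat.exists_eq_add_of_le' hg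
  have hn : (0 : ℝ) < ((n + 2 : ℕ) : ℝ) := by positivity
  have hcos : Real.cos (t / 2) ≤ 1 - 2 / Real.pi ^ 2 * (t / 2) ^ 2 :=
    Real.cos_le_one_sub_mul_cos_sq (by rw [abs_div, abs_two]; linarith)
  have hcos0 : 0 ≤ Real.cos (t / 2) := by
    have := abs_le.1 ht
    exact Real.cos_nonneg_of_neg_pi_div_two_le_of_le (by linarith) (by linarith)
  refine le_trans ?_ (Real.one_sub_le_exp_neg _)
  rw [uniformCharFun, abs_div, abs_of_pos hn, div_le_iff₀ hn, Finset.sum_range_succ',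
    Finset.sum_range_succ', add_assoc]
  set c : ℝ := (((n + 2 : ℕ) : ℝ) - 1) / 2
  have h1 : |∑ k ∈ Finset.range n, Real.cos ((((k + 1 + 1 : ℕ) : ℝ) - c) * t)| ≤ n := by
    refine (Finset.abs_sum_le_sum_abs _ _).trans ?_
    refine (Finset.sum_le_card_nsmul _ _ 1 fun k _ => Real.abs_cos_le_one _).trans ?_
    simp
  have h2 : |Real.cos ((((0 + 1 : ℕ) : ℝ) - c) * t) + Real.cos ((((0 : ℕ) : ℝ) - c) * t)| ≤
      2 * Real.cos (t / 2) := by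
    rw [Real.cos_add_cos, abs_mul, abs_mul, abs_two]
    have e : ((((0 + 1 : ℕ) : ℝ) - c) * t - (((0 : ℕ) : ℝ) - c) * t) / 2 = t / 2 := by
      push_cast
      ring
    rw [e, abs_of_nonneg hcos0]
    have := Real.abs_cos_le_one (((((0 + 1 : ℕ) : ℝ) - c) * t + (((0 : ℕ) : ℝ) - c) * t) / 2)
    nlinarith
  have e : (1 - 1 / (((n + 2 : ℕ) : ℝ) * Real.pi ^ 2) * t ^ 2) * ((n + 2 : ℕ) : ℝ) =
      n + 2 * (1 - 2 / Real.pi ^ 2 * (t / 2) ^ 2) := by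
    field_simp
    push_cast
    ring
  rw [e]
  refine (abs_add_le _ _).trans ?_
  linarith

lemma integral_exp_int_mul (m : ℤ) :
    ∫ t in (-Real.pi)..Real.pi, Complex.exp ((m : ℂ) * Complex.I * t) =
      if m = 0 then (2 * Real.pi : ℂ) else 0 := by
  split_ifs with h
  · subst h
    simp
    ring
  · have hm : (m : ℂ) * Complex.I ≠ 0 := mul_ne_zero (by exact_mod_cast h) Complex.I_ne_zero
    rw [integral_exp_mul_complex hm, div_eq_zero_iff]
    left
    rw [sub_eq_zero, Complex.exp_eq_exp_iff_exists_int]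
    refine ⟨m, ?_⟩
    push_cast
    ring

lemma Pg_eq_integral {g : ℕ} (hg : g ≠ 0) (T : ℕ) (ν : ℝ)
    (hν : ∃ z : ℤ, ν + T * ((g : ℝ) - 1) / 2 = z) :
    (2 * Real.pi : ℂ) * Pg g T ν =
      ∫ t in (-Real.pi)..Real.pi,
        (uniformCharFun g t : ℂ) ^ T * Complex.exp (Complex.I * (-ν : ℝ) * t) := by
  obtain ⟨z, hz⟩ := hν
  have hgC : (g : ℂ) ≠ 0 := by exact_mod_cast hg
  have hint (t : ℝ) :
      (uniformCharFun g t : ℂ) ^ T * Complex.exp (Complex.I * (-ν : ℝ) * t) =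
        ((g : ℂ) ^ T)⁻¹ * ∑ y : Fin T → Fin g,
          Complex.exp ((((∑ i, ((y i : ℕ) : ℤ)) - z : ℤ) : ℂ) * Complex.I * t) := by
    rw [uniformCharFun_eq_sum_exp, div_pow, Fintype.sum_pow, div_mul_eq_mul_div, div_eq_inv_mul,
      Finset.sum_mul]
    congr 1
    refine Finset.sum_congr rfl fun y _ => ?_
    rw [← Complex.exp_sum, ← Complex.exp_add]
    congr 1
    have hzC : (z : ℂ) = ν + T * ((g : ℂ) - 1) / 2 := by exact_mod_cast hz.symm
    push_cast
    rw [hzC, ← Finset.sum_mul, ← Finset.sum_mul, Finset.sum_sub_distrib]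
    simp only [Finset.sum_const, Finset.card_univ, Fintype.card_fin, nsmul_eq_mul]
    ring
  simp only [hint]
  rw [intervalIntegral.integral_const_mul, intervalIntegral.integral_finsetSum]
  · simp only [integral_exp_int_mul]
    rw [← Finset.sum_filter, Finset.sum_const, nsmul_eq_mul, Pg]
    have hfilter : (Finset.univ.filter
        (fun y : Fin T → Fin g => ∑ i, ((y i : ℕ) : ℝ) = ν + T * ((g : ℝ) - 1) / 2)) =
        Finset.univ.filter (fun y : Fin T → Fin g => ∑ i, ((y i : ℕ) : ℤ) - z = 0) := by
      refine Finset.filter_congr fun y _ => ?_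
      rw [hz, sub_eq_zero]
      exact_mod_cast Iff.rfl
    rw [hfilter]
    push_cast
    ring
  · intro y _
    exact Continuous.intervalIntegrable (by fun_prop) _ _

lemma gaussian_eq_integral {b : ℝ} (hb : 0 < b) (ν : ℝ) :
    (2 * Real.pi : ℂ) * (Real.exp (-(ν / Real.sqrt b) ^ 2 / 2) / Real.sqrt (2 * Real.pi * b) : ℝ) =
      ∫ t : ℝ, Complex.exp (Complex.I * (-ν : ℝ) * t) * (Real.exp (-(b * t ^ 2 / 2)) : ℝ) := by
  have hpi := Real.pi_pos
  have h := fourierIntegral_gaussian (b := ((b / 2 : ℝ) : ℂ))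
    (by rw [Complex.ofReal_re]; positivity) ((-ν : ℝ) : ℂ)
  have e (t : ℝ) : ((Real.exp (-(b * t ^ 2 / 2)) : ℝ) : ℂ) =
      Complex.exp (-((b / 2 : ℝ) : ℂ) * t ^ 2) := by
    push_cast
    congr 1
    ring
  simp only [e]
  rw [h]
  have h1 : ((Real.pi : ℂ) / ((b / 2 : ℝ) : ℂ)) ^ (1 / 2 : ℂ) =
      ((2 * Real.pi / Real.sqrt (2 * Real.pi * b) : ℝ) : ℂ) := by
    rw [← Complex.ofReal_div, show (1 / 2 : ℂ) = ((1 / 2 : ℝ) : ℂ) by push_cast; rfl,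
      ← Complex.ofReal_cpow (by positivity), ← Real.sqrt_eq_rpow]
    congr 1
    rw [eq_div_iff (by positivity), ← Real.sqrt_mul (by positivity)]
    rw [show Real.pi / (b / 2) * (2 * Real.pi * b) = (2 * Real.pi) ^ 2 by field_simp,
      Real.sqrt_sq (by positivity)]
  have h2 : Complex.exp (-((-ν : ℝ) : ℂ) ^ 2 / (4 * ((b / 2 : ℝ) : ℂ))) =
      ((Real.exp (-(ν / Real.sqrt b) ^ 2 / 2) : ℝ) : ℂ) := by
    rw [div_pow, Real.sq_sqrt hb.le]
    push_cast
    congr 1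
    have : (b : ℂ) ≠ 0 := by exact_mod_cast hb.ne'
    field_simp
    ring
  rw [h1, h2]
  push_cast
  ring

/-- Rate at which the characteristic function of a sum of `T` uniform variables approaches that of
the Gaussian with the same variance, uniformly on the real line. -/
lemma abs_indicator_pow_sub_exp_le {g : ℕ} (hg : 2 ≤ g) {T : ℕ} (hT : 1 ≤ T) (t : ℝ) :
    |(Set.Ioc (-Real.pi) Real.pi).indicator (fun t => uniformCharFun g t ^ T) t -
        Real.exp (-(((g : ℝ) ^ 2 - 1) / 12 * T * t ^ 2 / 2))| ≤
      4 * (g : ℝ) ^ 4 * Real.exp 1 * T *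
        (t ^ 4 * Real.exp (-(1 / (g * Real.pi ^ 2)) * (T * t ^ 2))) := by
  have hpi := Real.pi_gt_three
  have hg' : (2 : ℝ) ≤ g := by exact_mod_cast hg
  have hT' : (1 : ℝ) ≤ T := by exact_mod_cast hT
  have hg4 : (1 : ℝ) ≤ (g : ℝ) ^ 4 := one_le_pow₀ (by linarith)
  set a : ℝ := 1 / (g * Real.pi ^ 2) with ha
  set s : ℝ := ((g : ℝ) ^ 2 - 1) / 12 with hs
  have ha0 : 0 < a := by positivity
  have ha1 : a ≤ 1 / 8 := by
    rw [ha]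
    apply one_div_le_one_div_of_le (by norm_num)
    nlinarith
  have hs1 : 1 / 4 ≤ s := by
    rw [hs]
    nlinarith
  have hexp (u : ℝ) : Real.exp (-u) ^ T = Real.exp (-(T * u)) := by
    rw [← Real.exp_nat_mul]
    congr 1
    ring
  have hsa : Real.exp (-(s * t ^ 2 / 2)) ≤ Real.exp (-(a * t ^ 2)) := by
    apply Real.exp_le_exp.2
    nlinarith [sq_nonneg t]
  have hE : Real.exp (-(s * T * t ^ 2 / 2)) = Real.exp (-(s * t ^ 2 / 2)) ^ T := by
    rw [hexp]
    congr 1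
    ring
  have hA : Real.exp (-a * (T * t ^ 2)) = Real.exp (-(a * t ^ 2)) ^ T := by
    rw [hexp]
    congr 1
    ring
  rw [hE, hA]
  by_cases ht : t ∈ Set.Ioc (-Real.pi) Real.pi
  · rw [Set.indicator_of_mem ht]
    have ht' : |t| ≤ Real.pi := abs_le.2 ⟨ht.1.le, ht.2⟩
    have hφ := abs_uniformCharFun_le_exp hg ht'
    have hd := abs_uniformCharFun_sub_exp_le hg t
    rw [← ha] at hφ
    rw [← hs] at hd
    have hat : a * t ^ 2 ≤ 1 := by
      have : t ^ 2 ≤ Real.pi ^ 2 := by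
        rw [← sq_abs]
        gcongr
      calc a * t ^ 2 ≤ a * Real.pi ^ 2 := by gcongr
        _ = 1 / (g : ℝ) := by rw [ha]; field_simp
        _ ≤ 1 := by rw [div_le_one (by linarith)]; linarith
    have hpow : Real.exp (-(a * t ^ 2)) ^ (T - 1) ≤
        Real.exp 1 * Real.exp (-(a * t ^ 2)) ^ T := by
      obtain ⟨n, rfl⟩ := Nat.exists_eq_add_of_le' hT
      rw [Nat.add_sub_cancel, pow_succ (Real.exp (-(a * t ^ 2))), mul_left_comm, ← Real.exp_add]
      exact le_mul_of_one_le_right (by positivity) (Real.one_le_exp (by linarith))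
    calc _ ≤ _ := abs_pow_sub_pow_le _ _ _
      _ ≤ (4 * (g : ℝ) ^ 4 * t ^ 4) * T * (Real.exp 1 * Real.exp (-(a * t ^ 2)) ^ T) := by
        refine mul_le_mul (by gcongr) (le_trans ?_ hpow) (by positivity) (by positivity)
        exact pow_le_pow_left₀ (by positivity)
          (max_le hφ (by rw [abs_of_pos (Real.exp_pos _)]; exact hsa)) _
      _ = _ := by ring
  · rw [Set.indicator_of_notMem ht, zero_sub, abs_neg, abs_of_pos (by positivity)]
    have ht1 : 1 ≤ t ^ 4 := by
      have : 1 ≤ |t| := by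
        by_contra! h
        have := abs_lt.1 h
        exact ht ⟨by linarith, by linarith⟩
      have := one_le_pow₀ this (n := 4)
      rwa [← abs_pow, abs_of_nonneg (by positivity)] at this
    have he : 1 ≤ Real.exp 1 := Real.one_le_exp (by norm_num)
    calc Real.exp (-(s * t ^ 2 / 2)) ^ T ≤ Real.exp (-(a * t ^ 2)) ^ T := by gcongr
      _ = 1 * 1 * 1 * (1 * Real.exp (-(a * t ^ 2)) ^ T) := by ring
      _ ≤ 4 * (g : ℝ) ^ 4 * Real.exp 1 * T * (t ^ 4 * Real.exp (-(a * t ^ 2)) ^ T) := by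
        gcongr
        linarith

lemma integrable_pow_four_mul_exp {a : ℝ} (ha : 0 < a) :
    MeasureTheory.Integrable fun t : ℝ => t ^ 4 * Real.exp (-a * t ^ 2) := by
  simpa using integrable_rpow_mul_exp_neg_mul_sq ha (s := 4) (by norm_num)

lemma integral_pow_four_mul_exp_scale (a : ℝ) {T : ℝ} (hT : 0 < T) :
    ∫ t : ℝ, t ^ 4 * Real.exp (-a * (T * t ^ 2)) =
      T ^ (-(5 : ℝ) / 2) * ∫ t : ℝ, t ^ 4 * Real.exp (-a * t ^ 2) := by
  have h := MeasureTheory.Measure.integral_comp_mul_left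
    (fun t : ℝ => t ^ 4 * Real.exp (-a * t ^ 2)) (Real.sqrt T)
  have hsq : Real.sqrt T ^ 2 = T := Real.sq_sqrt hT.le
  have hs : 0 < Real.sqrt T := Real.sqrt_pos.2 hT
  have e (t : ℝ) : (Real.sqrt T * t) ^ 4 * Real.exp (-a * (Real.sqrt T * t) ^ 2) =
      T ^ 2 * (t ^ 4 * Real.exp (-a * (T * t ^ 2))) := by
    rw [mul_pow, mul_pow, show Real.sqrt T ^ 4 = (Real.sqrt T ^ 2) ^ 2 by ring, hsq]
    ring
  simp only [e] at h
  rw [MeasureTheory.integral_const_mul, abs_of_pos (by positivity), smul_eq_mul] at h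
  have hT5 : T ^ (-(5 : ℝ) / 2) = (T ^ 2)⁻¹ * (Real.sqrt T)⁻¹ := by
    rw [Real.sqrt_eq_rpow, ← Real.rpow_neg hT.le, ← Real.rpow_natCast, ← Real.rpow_neg hT.le,
      ← Real.rpow_add hT]
    norm_num
  rw [hT5, mul_assoc, ← h, inv_mul_cancel_left₀ (by positivity)]

theorem statement11 (g : ℕ) (hg : 2 ≤ g) :
    ∃ c : ℝ, 0 < c ∧ ∀ T : ℕ, 1 ≤ T → ∀ ν : ℝ,
      (∃ z : ℤ, ν + T * ((g : ℝ) - 1) / 2 = z) →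
      |Pg g T ν -
          Real.exp (-(ν / Real.sqrt ((((g : ℝ) ^ 2 - 1) / 12) * T)) ^ 2 / 2) /
            Real.sqrt (2 * Real.pi * (((g : ℝ) ^ 2 - 1) / 12) * T)| ≤
        c * (T : ℝ) ^ (-(3 : ℝ) / 2) := by
  have hpi := Real.pi_pos
  have hg' : (2 : ℝ) ≤ g := by exact_mod_cast hg
  set a : ℝ := 1 / (g * Real.pi ^ 2) with ha
  have ha0 : 0 < a := by positivity
  set J : ℝ := ∫ t : ℝ, t ^ 4 * Real.exp (-a * t ^ 2) with hJ
  have hJ0 : 0 ≤ J := MeasureTheory.integral_nonneg fun t => by positivity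
  refine ⟨(4 * (g : ℝ) ^ 4 * Real.exp 1 * J + 1) / (2 * Real.pi), by positivity, ?_⟩
  intro T hT ν hν
  have hT0 : (0 : ℝ) < T := by exact_mod_cast hT
  set s : ℝ := ((g : ℝ) ^ 2 - 1) / 12 with hs
  have hs0 : 0 < s := by
    rw [hs]
    nlinarith
  rw [mul_assoc (2 * Real.pi) s]
  set G : ℝ := Real.exp (-(ν / Real.sqrt (s * T)) ^ 2 / 2) / Real.sqrt (2 * Real.pi * (s * T))
  have hbound : MeasureTheory.Integrable fun t : ℝ => 4 * (g : ℝ) ^ 4 * Real.exp 1 * T *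
      (t ^ 4 * Real.exp (-a * (T * t ^ 2))) := by
    refine MeasureTheory.Integrable.const_mul ?_ _
    simpa only [neg_mul, mul_assoc] using integrable_pow_four_mul_exp (a := a * T) (by positivity)
  have hdiff : (2 * Real.pi : ℂ) * (Pg g T ν - G : ℝ) =
      ∫ t : ℝ, Complex.exp (Complex.I * (-ν : ℝ) * t) *
        (((Set.Ioc (-Real.pi) Real.pi).indicator (fun t => uniformCharFun g t ^ T) t -
          Real.exp (-(s * T * t ^ 2 / 2)) : ℝ) : ℂ) := by
    rw [Complex.ofReal_sub, mul_sub, Pg_eq_integral (by omega) T ν hν,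
      gaussian_eq_integral (by positivity) ν,
      intervalIntegral.integral_of_le (by linarith),
      ← MeasureTheory.integral_indicator measurableSet_Ioc, ← MeasureTheory.integral_sub]
    · refine MeasureTheory.integral_congr_ae (Filter.Eventually.of_forall fun t => ?_)
      by_cases ht : t ∈ Set.Ioc (-Real.pi) Real.pi
      · simp only [Set.indicator_of_mem ht]
        push_cast
        ring
      · simp only [Set.indicator_of_notMem ht]
        push_cast
        ring
    · rw [MeasureTheory.integrable_indicator_iff measurableSet_Ioc]
      have hc := continuous_uniformCharFun g
      exact (Continuous.integrableOn_Icc (by fun_prop)).mono_set Set.Ioc_subset_Icc_self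
    · have hG := (integrable_exp_neg_mul_sq (b := s * T / 2) (by positivity)).ofReal (𝕜 := ℂ)
      refine hG.mono (by fun_prop) (Filter.Eventually.of_forall fun t => le_of_eq ?_)
      rw [norm_mul, show Complex.I * (-ν : ℝ) * t = ((-ν * t : ℝ) : ℂ) * Complex.I by
        push_cast; ring, Complex.norm_exp_ofReal_mul_I, one_mul]
      congr 4
      ring
  have hnorm : ‖(2 * Real.pi : ℂ) * (Pg g T ν - G : ℝ)‖ ≤
      ∫ t : ℝ, 4 * (g : ℝ) ^ 4 * Real.exp 1 * T * (t ^ 4 * Real.exp (-a * (T * t ^ 2))) := by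
    rw [hdiff]
    refine MeasureTheory.norm_integral_le_of_norm_le hbound (Filter.Eventually.of_forall fun t => ?_)
    rw [norm_mul, show Complex.I * (-ν : ℝ) * t = ((-ν * t : ℝ) : ℂ) * Complex.I by
      push_cast; ring, Complex.norm_exp_ofReal_mul_I, one_mul, Complex.norm_real, Real.norm_eq_abs]
    exact abs_indicator_pow_sub_exp_le hg hT t
  rw [norm_mul, Complex.norm_real, Real.norm_eq_abs, MeasureTheory.integral_const_mul,
    integral_pow_four_mul_exp_scale a hT0, ← hJ,
    show ‖(2 * Real.pi : ℂ)‖ = 2 * Real.pi by simp [abs_of_pos hpi]] at hnorm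
  have hT3 : (T : ℝ) * (T : ℝ) ^ (-(5 : ℝ) / 2) = (T : ℝ) ^ (-(3 : ℝ) / 2) := by
    rw [← Real.rpow_one_add' hT0.le (by norm_num)]
    norm_num
  rw [div_mul_eq_mul_div, le_div_iff₀ (by positivity), ← hT3, mul_comm]
  refine hnorm.trans ?_
  have : 0 ≤ (T : ℝ) * (T : ℝ) ^ (-(5 : ℝ) / 2) := by positivity
  linarith
end
end

section
/- Let g ≥ 3 and set ℓ := ⌈384 g³ log K⌉. There exists K_0 = K_0(g) such that the following holds for all integers K ≥ K_0 and M with g^{K−1} < M ≤ g^K. Let k_1, k_2, k_3 be integers with |k_i − μ_K| ≤ C_g for i = 1,2,3, k_1 + k_2 + k_3 ≡ M (mod g−1), gcd(k_i, k_j) = 1 for i ≠ j, and gcd(k_i, g) = 1 for each i. Let B := {θ ∈ ℝ/ℤ : w_K((g−1)θ) ≤ ℓ}. Then for all integers j_1, j_2, j_3 with 0 ≤ j_i ≤ k_i − 1 for each i and (j_1, j_2, j_3) ∉ J, the intersection (B − j_1/k_1) ∩ (B − j_2/k_2) ∩ (B − j_3/k_3) is empty. -/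
set_option autoImplicit false

noncomputable section

/-- Left endpoint of the fundamental interval for the centred base-`g` expansion:
`-1/2` for odd `g` and `-(g-2)/(2(g-1))` for even `g`. -/
def Lg (g : ℕ) : ℝ :=
  if g % 2 = 1 then -(1 / 2) else -(((g : ℝ) - 2) / (2 * ((g : ℝ) - 1)))

/-- The `i`-th digit (`i ≥ 1`) of the centred base-`g` expansion of (the representative
modulo 1 of) `α`, chosen so that ambiguous expansions end in the minimal digit. -/
def centredDigit (g : ℕ) (α : ℝ) (i : ℕ) : ℤ :=
  ⌊(g : ℝ) ^ i * α - Lg g⌋ - g * ⌊(g : ℝ) ^ (i - 1) * α - Lg g⌋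

/-- `w_K(α)`: the number of nonzero digits among the first `K` digits of the centred
base-`g` expansion of `α`. -/
def wK (g K : ℕ) (α : ℝ) : ℕ :=
  ((Finset.Icc 1 K).filter fun i => centredDigit g α i ≠ 0).card

/-- `j` belongs to `{0, k/(g-1), 2k/(g-1), …, (g-2)k/(g-1)} ∩ ℤ`. -/
def inJ (g : ℕ) (k j : ℤ) : Prop := ∃ a : ℕ, a ≤ g - 2 ∧ j * ((g : ℤ) - 1) = (a : ℤ) * k

/-- The translate `B - x` of `B = {θ ∈ ℝ/ℤ : w_K((g-1)θ) ≤ ℓ}` by `x`, described by its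
(ℤ-periodic) set of representatives in `ℝ`. -/
def Btranslate (g K : ℕ) (x : ℝ) : Set ℝ :=
  {θ : ℝ | (wK g K (((g : ℝ) - 1) * (θ + x)) : ℤ) ≤ ellK g K}

/-- If fewer than `n` positions are excluded, one of
the first `n` blocks of length `L` avoids them. -/
theorem exists_block_disjoint (S : Finset ℕ) (n L : ℕ) (hS : S.card < n) :
    ∃ b < n, ∀ i, b * L < i → i ≤ (b + 1) * L → i ∉ S := by
  have hcard : (S.image fun i => (i - 1) / L).card < (Finset.range n).card := by
    rw [Finset.card_range]
    exact Finset.card_image_le.trans_lt hS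
  obtain ⟨b, hb, hb'⟩ := Finset.exists_mem_notMem_of_card_lt_card hcard
  refine ⟨b, Finset.mem_range.1 hb, fun i hi hi' hiS => hb' ?_⟩
  refine Finset.mem_image.2 ⟨i, hiS, Nat.div_eq_of_lt_le ?_ ?_⟩ <;> omega

theorem abs_Lg_le_one {g : ℕ} (hg : 3 ≤ g) : |Lg g| ≤ 1 := by
  have hg' : (3 : ℝ) ≤ g := by exact_mod_cast hg
  unfold Lg
  split_ifs
  · norm_num [abs_le]
  · rw [abs_neg, abs_of_nonneg (div_nonneg (by linarith) (by linarith)),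
      div_le_one (by linarith)]
    linarith

/-- A run of `L` zero digits after position `m` puts `g ^ m * α` within `2 / g ^ L` of `ℤ`. -/
theorem exists_int_near_of_zero_run {g : ℕ} (hg : 3 ≤ g) (α : ℝ) (m L : ℕ)
    (h : ∀ i, m < i → i ≤ m + L → centredDigit g α i = 0) :
    ∃ n : ℤ, (g : ℝ) ^ L * |(g : ℝ) ^ m * α - n| ≤ 2 := by
  have key : ∀ t ≤ L,
      ⌊(g : ℝ) ^ (m + t) * α - Lg g⌋ = (g : ℤ) ^ t * ⌊(g : ℝ) ^ m * α - Lg g⌋ := by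
    intro t
    induction t with
    | zero => simp
    | succ t ih =>
      intro ht
      have hdigit := h (m + (t + 1)) (by omega) (by omega)
      rw [centredDigit, show m + (t + 1) - 1 = m + t by omega, ih (by omega)] at hdigit
      rw [pow_succ]
      linarith
  refine ⟨⌊(g : ℝ) ^ m * α - Lg g⌋, ?_⟩
  have hL := key L le_rfl
  generalize ⌊(g : ℝ) ^ m * α - Lg g⌋ = n at hL ⊢
  rw [Int.floor_eq_iff] at hL
  push_cast at hL
  obtain ⟨h1, h2⟩ := hL
  rw [pow_add] at h1 h2
  obtain ⟨h3, h4⟩ := abs_le.1 (abs_Lg_le_one hg)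
  rw [← abs_of_nonneg (show (0 : ℝ) ≤ (g : ℝ) ^ L by positivity), ← abs_mul, abs_le]
  constructor <;> nlinarith

/-- Two numbers with few nonzero digits have a common run of zero digits. -/
theorem exists_int_near_sub {g : ℕ} (hg : 3 ≤ g) (K w L : ℕ) (α β : ℝ)
    (hα : wK g K α ≤ w) (hβ : wK g K β ≤ w) (hK : (2 * w + 1) * L ≤ K) :
    ∃ (m : ℕ) (n : ℤ), (g : ℝ) ^ L * |(g : ℝ) ^ m * (α - β) - n| ≤ 4 := by
  unfold wK at hα hβ
  set S := (Finset.Icc 1 K).filter fun i => centredDigit g α i ≠ 0 with hSdef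
  set T := (Finset.Icc 1 K).filter fun i => centredDigit g β i ≠ 0 with hTdef
  have hcard : (S ∪ T).card < 2 * w + 1 := by
    have := Finset.card_union_le S T
    omega
  obtain ⟨b, hb, hrun⟩ := exists_block_disjoint (S ∪ T) (2 * w + 1) L hcard
  have hbK : (b + 1) * L ≤ K := (Nat.mul_le_mul_right L hb).trans hK
  have hmem : ∀ i, b * L < i → i ≤ b * L + L →
      centredDigit g α i = 0 ∧ centredDigit g β i = 0 := by
    intro i hi hi'
    rw [← Nat.succ_mul] at hi'
    have hnot := hrun i hi hi'
    have hIcc : i ∈ Finset.Icc 1 K := Finset.mem_Icc.2 ⟨by omega, hi'.trans hbK⟩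
    simpa [hSdef, hTdef, Finset.mem_Icc.1 hIcc] using hnot
  obtain ⟨n, hn⟩ := exists_int_near_of_zero_run hg α (b * L) L fun i hi hi' => (hmem i hi hi').1
  obtain ⟨n', hn'⟩ := exists_int_near_of_zero_run hg β (b * L) L fun i hi hi' => (hmem i hi hi').2
  refine ⟨b * L, n - n', ?_⟩
  have htri := abs_sub ((g : ℝ) ^ (b * L) * α - n) ((g : ℝ) ^ (b * L) * β - n')
  have heq : (g : ℝ) ^ (b * L) * (α - β) - ((n - n' : ℤ) : ℝ) =
      ((g : ℝ) ^ (b * L) * α - n) - ((g : ℝ) ^ (b * L) * β - n') := by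
    push_cast; ring
  rw [heq]
  have := mul_le_mul_of_nonneg_left htri (show (0 : ℝ) ≤ (g : ℝ) ^ L by positivity)
  linarith

theorem inJ_of_dvd {g : ℕ} (hg : 3 ≤ g) {k j : ℤ} (hj : 0 ≤ j) (hjk : j ≤ k - 1)
    (hdvd : k ∣ j * ((g : ℤ) - 1)) : inJ g k j := by
  obtain ⟨a, ha⟩ := hdvd
  have hk : 0 < k := by omega
  have hg' : (0 : ℤ) < (g : ℤ) - 1 := by omega
  have ha0 : 0 ≤ a := by
    have : 0 ≤ k * a := ha ▸ mul_nonneg hj hg'.le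
    exact nonneg_of_mul_nonneg_right this hk
  have hlt : a < (g : ℤ) - 1 := by
    refine lt_of_mul_lt_mul_left ?_ hk.le
    rw [← ha]
    exact mul_lt_mul_of_pos_right (by omega) hg'
  lift a to ℕ using ha0
  exact ⟨a, by omega, by rw [ha, mul_comm]⟩

theorem dvd_and_dvd_of_sparse {g : ℕ} (hg : 3 ≤ g) (K w L : ℕ) (θ : ℝ) {k k' j j' : ℤ}
    (hk : 0 < k) (hk' : 0 < k') (hcop : IsCoprime k k') (hkg : IsCoprime k (g : ℤ))
    (hkg' : IsCoprime k' (g : ℤ))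
    (h : wK g K (((g : ℝ) - 1) * (θ + (j : ℝ) / k)) ≤ w)
    (h' : wK g K (((g : ℝ) - 1) * (θ + (j' : ℝ) / k')) ≤ w)
    (hK : (2 * w + 1) * L ≤ K) (hL : 4 * ((k : ℝ) * k') < (g : ℝ) ^ L) :
    k ∣ j * ((g : ℤ) - 1) ∧ k' ∣ j' * ((g : ℤ) - 1) := by
  obtain ⟨m, n, hmn⟩ := exists_int_near_sub hg K w L _ _ h h' hK
  have hkR : (0 : ℝ) < k := by exact_mod_cast hk
  have hkR' : (0 : ℝ) < k' := by exact_mod_cast hk'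
  set N : ℤ := ((g : ℤ) - 1) * (j * k' - j' * k) with hN
  have hscale : (g : ℝ) ^ m * (((g : ℝ) - 1) * (θ + (j : ℝ) / k) -
      ((g : ℝ) - 1) * (θ + (j' : ℝ) / k')) - n =
      (((g : ℤ) ^ m * N - k * k' * n : ℤ) : ℝ) / (k * k') := by
    rw [hN]
    push_cast
    field_simp
    ring
  have hzero : (g : ℤ) ^ m * N - k * k' * n = 0 := by
    rw [hscale, abs_div, abs_of_pos (mul_pos hkR hkR'), mul_div_assoc',
      div_le_iff₀ (by positivity)] at hmn
    have hlt := hmn.trans_lt hL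
    have hgL : (0 : ℝ) < (g : ℝ) ^ L := by positivity
    have hone : |(((g : ℤ) ^ m * N - k * k' * n : ℤ) : ℝ)| < 1 := by
      refine lt_of_mul_lt_mul_left ?_ hgL.le
      rwa [mul_one]
    rw [← Int.abs_lt_one_iff]
    exact_mod_cast hone
  have hdvd : k * k' ∣ N :=
    ((hkg.mul_left hkg').pow_right (n := m)).dvd_of_dvd_mul_left ⟨n, by linarith⟩
  constructor
  · have h1 : k ∣ j * ((g : ℤ) - 1) * k' := by
      obtain ⟨c, hc⟩ := (dvd_mul_right k k').trans hdvd
      exact ⟨c + ((g : ℤ) - 1) * j', by rw [hN] at hc; linear_combination hc⟩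
    exact hcop.dvd_of_dvd_mul_right h1
  · have h1 : k' ∣ j' * ((g : ℤ) - 1) * k := by
      obtain ⟨c, hc⟩ := (dvd_mul_left k' k).trans hdvd
      exact ⟨((g : ℤ) - 1) * j - c, by rw [hN] at hc; linear_combination -hc⟩
    exact hcop.symm.dvd_of_dvd_mul_right h1

open Filter Asymptotics in
theorem eventually_block_parameters {g : ℕ} (hg : 3 ≤ g) :
    ∃ s0 : ℕ, ∀ s ≥ s0, ∀ K : ℕ, 1 ≤ K → K < (s + 1) ^ 2 →
      2 * ((ellK g K).toNat : ℝ) + 1 ≤ s ∧ 4 * ((g : ℝ) * K) ^ 2 < (g : ℝ) ^ s := by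
  have hg' : (3 : ℝ) ≤ g := by exact_mod_cast hg
  set c : ℝ := 384 * (g : ℝ) ^ 3 with hc
  have hcpos : 0 < c := by positivity
  have hshift : Tendsto (fun s : ℕ => ((s : ℝ) + 1)) atTop atTop :=
    tendsto_atTop_add_const_right _ _ tendsto_natCast_atTop_atTop
  have hlog : ∀ᶠ s : ℕ in atTop, ‖Real.log ((s : ℝ) + 1)‖ ≤ 1 / (8 * c) * ‖(s : ℝ) + 1‖ :=
    (Real.isLittleO_log_id_atTop.comp_tendsto hshift).def (by positivity)
  have hpow : ∀ᶠ s : ℕ in atTop, ((s : ℝ) + 1) ^ 4 / (g : ℝ) ^ (s + 1) < 1 / (4 * (g : ℝ) ^ 3) := by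
    have ht := (tendsto_pow_const_div_const_pow_of_one_lt 4 (show (1 : ℝ) < g by linarith)).comp
      (tendsto_add_atTop_nat 1)
    have := ht.eventually (gt_mem_nhds (show (0 : ℝ) < 1 / (4 * (g : ℝ) ^ 3) by positivity))
    filter_upwards [this] with s hs
    simpa using hs
  obtain ⟨s0, hs0⟩ := eventually_atTop.1 (hlog.and (hpow.and (eventually_ge_atTop 10)))
  refine ⟨s0, fun s hs K hK1 hKs => ?_⟩
  obtain ⟨h1, h2, h3⟩ := hs0 s hs
  have h3' : (10 : ℝ) ≤ s := by exact_mod_cast h3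
  have hK1' : (1 : ℝ) ≤ K := by exact_mod_cast hK1
  have hKs' : (K : ℝ) ≤ ((s : ℝ) + 1) ^ 2 := by exact_mod_cast hKs.le
  constructor
  · rw [Real.norm_of_nonneg (Real.log_nonneg (by linarith)),
      Real.norm_of_nonneg (by linarith)] at h1
    have hlogK : Real.log K ≤ 2 * Real.log ((s : ℝ) + 1) := by
      have := Real.log_le_log (by linarith) hKs'
      rwa [Real.log_pow, Nat.cast_ofNat] at this
    have hell : ((ellK g K).toNat : ℝ) ≤ c * Real.log K + 1 := by
      have hnn : 0 ≤ ellK g K :=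
        Int.ceil_nonneg (mul_nonneg hcpos.le (Real.log_nonneg hK1'))
      have hcast : ((ellK g K).toNat : ℝ) = (ellK g K : ℝ) := by
        exact_mod_cast congrArg (Int.cast (R := ℝ)) (Int.toNat_of_nonneg hnn)
      rw [hcast]
      exact (Int.ceil_lt_add_one _).le
    have h4 : c * Real.log K ≤ ((s : ℝ) + 1) / 4 := by
      calc c * Real.log K ≤ c * (2 * (1 / (8 * c) * ((s : ℝ) + 1))) := by gcongr; linarith
        _ = ((s : ℝ) + 1) / 4 := by field_simp; norm_num
    linarith
  · rw [div_lt_div_iff₀ (by positivity) (by positivity), one_mul, pow_succ (g : ℝ) s] at h2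
    have h4 : (g : ℝ) * (4 * (g : ℝ) ^ 2 * ((s : ℝ) + 1) ^ 4) < g * (g : ℝ) ^ s := by
      linarith
    have h5 := lt_of_mul_lt_mul_left h4 (by positivity)
    refine lt_of_le_of_lt ?_ h5
    have h6 : (K : ℝ) ^ 2 ≤ (((s : ℝ) + 1) ^ 2) ^ 2 := by gcongr
    rw [mul_pow, ← mul_assoc]
    gcongr
    linarith

theorem statement17 (g : ℕ) (hg : 3 ≤ g) :
    ∃ K0 : ℕ, ∀ K : ℕ, K0 ≤ K →
      ∀ M : ℕ, g ^ (K - 1) < M → M ≤ g ^ K →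
      ∀ k1 k2 k3 : ℤ,
        |(k1 : ℝ) - muK g K| ≤ Cg g →
        |(k2 : ℝ) - muK g K| ≤ Cg g →
        |(k3 : ℝ) - muK g K| ≤ Cg g →
        k1 + k2 + k3 ≡ (M : ℤ) [ZMOD ((g : ℤ) - 1)] →
        Int.gcd k1 k2 = 1 → Int.gcd k1 k3 = 1 → Int.gcd k2 k3 = 1 →
        Int.gcd k1 (g : ℤ) = 1 → Int.gcd k2 (g : ℤ) = 1 → Int.gcd k3 (g : ℤ) = 1 →
      ∀ j1 j2 j3 : ℤ,
        0 ≤ j1 → j1 ≤ k1 - 1 → 0 ≤ j2 → j2 ≤ k2 - 1 → 0 ≤ j3 → j3 ≤ k3 - 1 →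
        ¬(inJ g k1 j1 ∧ inJ g k2 j2 ∧ inJ g k3 j3) →
        Btranslate g K ((j1 : ℝ) / (k1 : ℝ)) ∩ Btranslate g K ((j2 : ℝ) / (k2 : ℝ)) ∩
          Btranslate g K ((j3 : ℝ) / (k3 : ℝ)) = ∅ := by
  obtain ⟨s0, hs0⟩ := eventually_block_parameters hg
  refine ⟨s0 * s0 + 2 * Cg g + 1, ?_⟩
  intro K hK M _ _ k1 k2 k3 hk1 hk2 hk3 _ h12 h13 _ h1g h2g h3g j1 j2 j3 hj1 hj1' hj2 hj2'
    hj3 hj3' hJ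
  have hgR : (3 : ℝ) ≤ g := by exact_mod_cast hg
  obtain ⟨hell, hpow⟩ := hs0 (Nat.sqrt K) (Nat.le_sqrt.2 (by omega)) K (by omega)
    (by rw [pow_two]; exact Nat.lt_succ_sqrt K)
  have hbound : ∀ k : ℤ, |(k : ℝ) - muK g K| ≤ Cg g → (k : ℝ) ≤ g * K := by
    intro k hk
    have hKR : 2 * (Cg g : ℝ) ≤ K := by exact_mod_cast (show 2 * Cg g ≤ K by omega)
    have hk' := (abs_le.1 hk).2
    unfold muK at hk'
    nlinarith [mul_nonneg (show (0 : ℝ) ≤ g by positivity) (Nat.cast_nonneg (α := ℝ) K)]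
  have hrunK : (2 * (ellK g K).toNat + 1) * Nat.sqrt K ≤ K := by
    have : 2 * (ellK g K).toNat + 1 ≤ Nat.sqrt K := by exact_mod_cast hell
    exact (Nat.mul_le_mul_right _ this).trans (Nat.sqrt_le K)
  have hprod : ∀ k k' : ℤ, 0 < k → 0 < k' → (k : ℝ) ≤ g * K → (k' : ℝ) ≤ g * K →
      4 * ((k : ℝ) * k') < (g : ℝ) ^ Nat.sqrt K := by
    intro k k' hk hk' hb hb'
    refine lt_of_le_of_lt ?_ hpow
    have : (0 : ℝ) ≤ k' := by exact_mod_cast hk'.le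
    rw [pow_two]
    gcongr
  rw [Set.eq_empty_iff_forall_notMem]
  rintro θ ⟨⟨hθ1, hθ2⟩, hθ3⟩
  simp only [Btranslate, Set.mem_ofPred_eq] at hθ1 hθ2 hθ3
  replace hθ1 := Int.ofNat_le.1 (hθ1.trans (Int.self_le_toNat _))
  replace hθ2 := Int.ofNat_le.1 (hθ2.trans (Int.self_le_toNat _))
  replace hθ3 := Int.ofNat_le.1 (hθ3.trans (Int.self_le_toNat _))
  have hc := fun {a b : ℤ} (h : Int.gcd a b = 1) => Int.isCoprime_iff_gcd_eq_one.2 h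
  have hp1 : 0 < k1 := by omega
  have hp2 : 0 < k2 := by omega
  have hp3 : 0 < k3 := by omega
  obtain ⟨hd1, hd2⟩ := dvd_and_dvd_of_sparse hg K _ _ θ hp1 hp2 (hc h12) (hc h1g) (hc h2g)
    hθ1 hθ2 hrunK (hprod _ _ hp1 hp2 (hbound _ hk1) (hbound _ hk2))
  obtain ⟨-, hd3⟩ := dvd_and_dvd_of_sparse hg K _ _ θ hp1 hp3 (hc h13) (hc h1g) (hc h3g)
    hθ1 hθ3 hrunK (hprod _ _ hp1 hp3 (hbound _ hk1) (hbound _ hk3))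
  exact hJ ⟨inJ_of_dvd hg hj1 hj1' hd1, inJ_of_dvd hg hj2 hj2' hd2, inJ_of_dvd hg hj3 hj3' hd3⟩
end
end
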